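/- arXiv:1903.01805 — 2 statements merged into one kernel-verified Lean document; each statement's English description precedes it below -/
import Mathlib

section
/- For every integer k ≥ 0, the graph G_k admits a (k+1)-bend CPG representation but admits no k-bend CPG representation (i.e., G_k is B_{k+1}-CPG but not B_k-CPG). -/
/-! ## Grid paths and CPG representations -/

/-- Two grid points of `ℤ × ℤ` at L¹-distance 1 (i.e. joined by a unit grid segment). -/
def GridStep (p q : ℤ × ℤ) : Prop :=
  (p.1 - q.1).natAbs + (p.2 - q.2).natAbs = 1

/-- A grid path: a sequence of at least two grid points, consecutive points at distance 1,
with no repeated grid point (so the traced curve neither crosses nor retraces itself). -/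
structure GridPath where
  pts : List (ℤ × ℤ)
  two_le_length : 2 ≤ pts.length
  step : pts.Chain' GridStep
  nodup : pts.Nodup

namespace GridPath

theorem ne_nil (P : GridPath) : P.pts ≠ [] := by
  intro h
  have h2 := P.two_le_length
  rw [h] at h2
  simp at h2

/-- The set of grid points of a grid path. -/
def toSet (P : GridPath) : Set (ℤ × ℤ) := {p | p ∈ P.pts}

/-- The first extreme point of a grid path. -/
def first (P : GridPath) : ℤ × ℤ := P.pts.head P.ne_nil

/-- The second extreme point of a grid path. -/
def last (P : GridPath) : ℤ × ℤ := P.pts.getLast P.ne_nil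

/-- `p` is an endpoint (extreme point) of the grid path `P`. -/
def IsEndpoint (P : GridPath) (p : ℤ × ℤ) : Prop := p = P.first ∨ p = P.last

/-- `p` is an interior grid point of `P`: it lies on `P` but is not an endpoint. -/
def IsInterior (P : GridPath) (p : ℤ × ℤ) : Prop := p ∈ P.toSet ∧ ¬ P.IsEndpoint p

/-- `p` is a bend of `P`: an interior grid point at which `P` turns 90 degrees. -/
def IsBend (P : GridPath) (p : ℤ × ℤ) : Prop :=
  ∃ a c : ℤ × ℤ, [a, p, c] <:+: P.pts ∧ a.1 ≠ c.1 ∧ a.2 ≠ c.2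

/-- The set of bend points of `P`. -/
def bendSet (P : GridPath) : Set (ℤ × ℤ) := {p | P.IsBend p}

/-- `P` has at most `k` bends. -/
def BendsAtMost (P : GridPath) (k : ℕ) : Prop := P.bendSet.ncard ≤ k

end GridPath

/-- `p` and `q` are consecutive grid points of the list `l` (in either order);
equivalently, the path traced by `l` uses the unit grid segment joining `p` and `q`. -/
def ConsecIn (l : List (ℤ × ℤ)) (p q : ℤ × ℤ) : Prop :=
  [p, q] <:+: l ∨ [q, p] <:+: l

/-- A CPG representation of a simple graph `G`: a family of pairwise interiorly disjoint
grid paths, one for each vertex, such that two distinct vertices are adjacent iff the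
corresponding paths have a common point. -/
structure CPGRep {V : Type*} (G : SimpleGraph V) where
  path : V → GridPath
  interiorly_disjoint : ∀ u v : V, u ≠ v → ∀ p : ℤ × ℤ,
    p ∈ (path u).toSet → p ∈ (path v).toSet →
    (path u).IsEndpoint p ∨ (path v).IsEndpoint p
  no_shared_segment : ∀ u v : V, u ≠ v → ∀ p q : ℤ × ℤ,
    ConsecIn (path u).pts p q → ¬ ConsecIn (path v).pts p q
  adj_iff : ∀ u v : V, u ≠ v →
    (G.Adj u v ↔ ∃ p : ℤ × ℤ, p ∈ (path u).toSet ∧ p ∈ (path v).toSet)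

namespace CPGRep

variable {V : Type*} {G : SimpleGraph V}

/-- A `k`-bend CPG representation: every path has at most `k` bends. -/
def BendsAtMost (R : CPGRep G) (k : ℕ) : Prop :=
  ∀ u : V, (R.path u).BendsAtMost k

/-- `p` is a free endpoint of the path of `u`: an endpoint of `R.path u`
belonging to no other path of the representation. -/
def FreeEndpoint (R : CPGRep G) (u : V) (p : ℤ × ℤ) : Prop :=
  (R.path u).IsEndpoint p ∧ ∀ v : V, v ≠ u → p ∉ (R.path v).toSet

end CPGRep

/-- A graph is CPG if it admits a CPG representation. -/
def IsCPG {V : Type*} (G : SimpleGraph V) : Prop := Nonempty (CPGRep G)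

/-- A graph is `B_k`-CPG if it admits a CPG representation in which every path
has at most `k` bends. -/
def IsBkCPG {V : Type*} (G : SimpleGraph V) (k : ℕ) : Prop :=
  ∃ R : CPGRep G, R.BendsAtMost k

/-! ## The graph `G_k` -/

/-- Vertices of the graph `G_k`: the two special vertices `a`, `b`, the twenty secondary
vertices `α 0, …, α 19` (representing `α_1, …, α_20`), and the sewing vertices
`u i j` for `i : Fin 19`, `j : Fin (k+2)` (representing `u^{i+1}_{j+1}`). -/
inductive GkV (k : ℕ) where
  | a : GkV k
  | b : GkV k
  | α : Fin 20 → GkV k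
  | u : Fin 19 → Fin (k + 2) → GkV k

/-- The defining relation of `G_k`: `ab`; `aα_i`, `bα_i`; `α_i u^i_j`, `α_{i+1} u^i_j`;
and `u^i_j u^i_{j+1}`. -/
inductive GkRel (k : ℕ) : GkV k → GkV k → Prop
  | ab : GkRel k (GkV.a) (GkV.b)
  | aα (i : Fin 20) : GkRel k (GkV.a) (GkV.α i)
  | bα (i : Fin 20) : GkRel k (GkV.b) (GkV.α i)
  | αu (i : Fin 19) (j : Fin (k + 2)) : GkRel k (GkV.α i.castSucc) (GkV.u i j)
  | α'u (i : Fin 19) (j : Fin (k + 2)) : GkRel k (GkV.α i.succ) (GkV.u i j)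
  | uu (i : Fin 19) (j j' : Fin (k + 2)) (h : (j : ℕ) + 1 = (j' : ℕ)) :
      GkRel k (GkV.u i j) (GkV.u i j')

/-- The graph `G_k`. -/
def Gk (k : ℕ) : SimpleGraph (GkV k) := SimpleGraph.fromRel (GkRel k)

/-- A secondary path `P_{α_i}` (more generally, the path of a vertex `w`) is pure if no
endpoint of `P_a` or of `P_b` belongs to it. -/
def IsPure {k : ℕ} (R : CPGRep (Gk k)) (w : GkV k) : Prop :=
  ∀ p : ℤ × ℤ,
    ((R.path GkV.a).IsEndpoint p ∨ (R.path GkV.b).IsEndpoint p) →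
    p ∉ (R.path w).toSet

/-! ### Part A: parity of closed grid walks -/

namespace GkProof

/-- Sum of an edge function over consecutive pairs of a list. -/
def es (F : ℤ × ℤ → ℤ × ℤ → ZMod 2) : List (ℤ × ℤ) → ZMod 2
  | [] => 0
  | [_] => 0
  | a :: b :: l => F a b + es F (b :: l)

def hE (v a b : ℤ × ℤ) : ZMod 2 :=
  if a.2 = v.2 ∧ b.2 = v.2 ∧ ((a.1 = v.1 ∧ b.1 = v.1 + 1) ∨ (b.1 = v.1 ∧ a.1 = v.1 + 1))
  then 1 else 0

def vE (v a b : ℤ × ℤ) : ZMod 2 :=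
  if a.1 = v.1 ∧ b.1 = v.1 ∧ ((a.2 = v.2 ∧ b.2 = v.2 + 1) ∨ (b.2 = v.2 ∧ a.2 = v.2 + 1))
  then 1 else 0

def cE (v a b : ℤ × ℤ) : ZMod 2 :=
  if a.2 = b.2 ∧ a.2 ≤ v.2 ∧ ((a.1 = v.1 ∧ b.1 = v.1 + 1) ∨ (b.1 = v.1 ∧ a.1 = v.1 + 1))
  then 1 else 0

def bE (v a : ℤ × ℤ) : ZMod 2 := if a.1 = v.1 ∧ a.2 ≤ v.2 then 1 else 0

theorem two_eq : (1 + 1 : ZMod 2) = 0 := by decide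

theorem loc_h (x y : ℤ) (a b : ℤ × ℤ) (h : GridStep a b) :
    cE (x, y) a b + cE (x, y - 1) a b = hE (x, y) a b := by
  unfold GridStep at h
  unfold cE hE
  split_ifs <;> first | rfl | (exfalso; simp only at *; omega)

theorem loc_v (x y : ℤ) (a b : ℤ × ℤ) (h : GridStep a b) :
    cE (x, y) a b + cE (x - 1, y) a b + vE (x, y) a b = bE (x, y) a + bE (x, y) b := by
  unfold GridStep at h
  unfold cE vE bE
  split_ifs <;> first | rfl | (exfalso; simp only at *; omega)

theorem es_h (x y : ℤ) : ∀ l : List (ℤ × ℤ), l.IsChain GridStep →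
    es (cE (x, y)) l + es (cE (x, y - 1)) l = es (hE (x, y)) l
  | [], _ => by simp [es]
  | [_], _ => by simp [es]
  | a :: b :: l, h => by
    rw [List.isChain_cons_cons] at h
    have h1 := loc_h x y a b h.1
    have h2 := es_h x y (b :: l) h.2
    simp only [es]
    rw [← h1, ← h2]; ring

theorem es_v (x y : ℤ) : ∀ (l : List (ℤ × ℤ)) (p q : ℤ × ℤ), l.IsChain GridStep →
    l.head? = some p → l.getLast? = some q →
    es (cE (x, y)) l + es (cE (x - 1, y)) l + es (vE (x, y)) l = bE (x, y) p + bE (x, y) q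
  | [], _, _, _, h, _ => by simp at h
  | [a], p, q, _, h, h' => by
    simp at h h'
    subst h; subst h'
    simp [es, CharTwo.add_self_eq_zero]
  | a :: b :: l, p, q, h, hp, hq => by
    rw [List.isChain_cons_cons] at h
    simp at hp
    subst hp
    have h1 := loc_v x y a b h.1
    have h2 := es_v x y (b :: l) b q h.2 (by simp) (by simpa using hq)
    simp only [es]
    have h3 : bE (x, y) b + bE (x, y) b = 0 := CharTwo.add_self_eq_zero _
    linear_combination h1 + h2 + h3

theorem es_zero (F : ℤ × ℤ → ℤ × ℤ → ZMod 2) (v : ℤ × ℤ)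
    (hF : ∀ a b, a ≠ v → b ≠ v → F a b = 0) :
    ∀ l : List (ℤ × ℤ), v ∉ l → es F l = 0
  | [], _ => rfl
  | [_], _ => rfl
  | a :: b :: l, h => by
    simp only [es]
    rw [es_zero F v hF (b :: l) (fun h' => h (List.mem_cons_of_mem _ h')), hF a b]
    · simp
    · rintro rfl; simp at h
    · rintro rfl; simp at h

theorem hE_zero (v a b : ℤ × ℤ) (ha : a ≠ v) (hb : b ≠ v) : hE v a b = 0 := by
  unfold hE
  rw [if_neg]
  rintro ⟨h1, h2, h3 | h3⟩
  · exact ha (Prod.ext h3.1 h1)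
  · exact hb (Prod.ext h3.1 h2)

theorem vE_zero (v a b : ℤ × ℤ) (ha : a ≠ v) (hb : b ≠ v) : vE v a b = 0 := by
  unfold vE
  rw [if_neg]
  rintro ⟨h1, h2, h3 | h3⟩
  · exact ha (Prod.ext h1 h3.1)
  · exact hb (Prod.ext h2 h3.1)

theorem exists_pot (l1 l2 l3 : List (ℤ × ℤ)) (p q1 q2 : ℤ × ℤ)
    (c1 : l1.IsChain GridStep) (c2 : l2.IsChain GridStep) (c3 : l3.IsChain GridStep)
    (h1 : l1.head? = some p) (h1' : l1.getLast? = some q1)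
    (h2 : l2.head? = some q1) (h2' : l2.getLast? = some q2)
    (h3 : l3.head? = some p) (h3' : l3.getLast? = some q2) :
    ∃ g : ℤ × ℤ → ZMod 2,
      (∀ x y, g (x, y) + g (x, y - 1) =
        es (hE (x, y)) l1 + es (hE (x, y)) l2 + es (hE (x, y)) l3) ∧
      (∀ x y, g (x, y) + g (x - 1, y) =
        es (vE (x, y)) l1 + es (vE (x, y)) l2 + es (vE (x, y)) l3) := by
  refine ⟨fun v => es (cE v) l1 + es (cE v) l2 + es (cE v) l3, ?_, ?_⟩
  · intro x y
    have e1 := es_h x y l1 c1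
    have e2 := es_h x y l2 c2
    have e3 := es_h x y l3 c3
    linear_combination e1 + e2 + e3
  · intro x y
    have e1 := es_v x y l1 p q1 c1 h1 h1'
    have e2 := es_v x y l2 q1 q2 c2 h2 h2'
    have e3 := es_v x y l3 p q2 c3 h3 h3'
    have t : (2 : ZMod 2) = 0 := by decide
    linear_combination e1 + e2 + e3 + (bE (x, y) p + bE (x, y) q1 + bE (x, y) q2
      - es (vE (x, y)) l1 - es (vE (x, y)) l2 - es (vE (x, y)) l3) * t

theorem pot_const (D : List (ℤ × ℤ)) (g : ℤ × ℤ → ZMod 2)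
    (H : ∀ v, v ∉ D → g v = g (v.1, v.2 - 1) ∧ g v = g (v.1 - 1, v.2))
    (a b : ℤ × ℤ) (h : GridStep a b) (ha : a ∉ D) (hb : b ∉ D) : g a = g b := by
  obtain ⟨a1, a2⟩ := a
  obtain ⟨b1, b2⟩ := b
  have Ha := H _ ha
  have Hb := H _ hb
  simp only [GridStep] at h
  have : (b1 = a1 ∧ b2 = a2 - 1) ∨ (b1 = a1 - 1 ∧ b2 = a2) ∨ (a1 = b1 ∧ a2 = b2 - 1) ∨
    (a1 = b1 - 1 ∧ a2 = b2) := by omega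
  rcases this with ⟨rfl, rfl⟩ | ⟨rfl, rfl⟩ | ⟨rfl, rfl⟩ | ⟨rfl, rfl⟩
  · exact Ha.1
  · exact Ha.2
  · exact Hb.1.symm
  · exact Hb.2.symm

theorem arith_cross (p1 p2 x1 x2 y1 y2 a1 a2 b1 b2 : ℤ)
    (sx : (x1 - p1).natAbs + (x2 - p2).natAbs = 1) (sy : (p1 - y1).natAbs + (p2 - y2).natAbs = 1)
    (s1 : (p1 - a1).natAbs + (p2 - a2).natAbs = 1) (s3 : (p1 - b1).natAbs + (p2 - b2).natAbs = 1)
    (h : x1 = y1) (xy : ¬ (x1 = y1 ∧ x2 = y2)) (h1 : ¬ (a1 = x1 ∧ a2 = x2))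
    (h2 : ¬ (a1 = y1 ∧ a2 = y2)) (h3 : ¬ (b1 = x1 ∧ b2 = x2))
    (h4 : ¬ (b1 = y1 ∧ b2 = y2)) (h5 : ¬ (a1 = b1 ∧ a2 = b2)) :
    (a1 = p1 + 1 ∧ a2 = p2 ∧ b1 = p1 - 1 ∧ b2 = p2) ∨
      (a1 = p1 - 1 ∧ a2 = p2 ∧ b1 = p1 + 1 ∧ b2 = p2) := by
  have e : x1 = p1 := by
    clear * - sx sy h xy
    omega
  subst e
  subst h
  have ha : a2 = p2 := by
    clear * - sx sy s1 h1 h2 xy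
    omega
  have hb : b2 = p2 := by
    clear * - sx sy s3 h3 h4 xy
    omega
  subst ha
  subst hb
  clear * - s1 s3 h5
  omega

theorem straight_pot (x p y r1 r3 q1 q2 : ℤ × ℤ) (m1 m3 l2 : List (ℤ × ℤ))
    (c1 : (p :: r1 :: m1).IsChain GridStep) (c2 : l2.IsChain GridStep)
    (c3 : (p :: r3 :: m3).IsChain GridStep)
    (h1' : (p :: r1 :: m1).getLast? = some q1)
    (h2 : l2.head? = some q1) (h2' : l2.getLast? = some q2)
    (h3' : (p :: r3 :: m3).getLast? = some q2)
    (n1 : p ∉ r1 :: m1) (n3 : p ∉ r3 :: m3) (n2 : p ∉ l2)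
    (sx : GridStep x p) (sy : GridStep p y) (xy : x ≠ y)
    (hr : r1 ≠ r3) (hr1x : r1 ≠ x) (hr1y : r1 ≠ y) (hr3x : r3 ≠ x) (hr3y : r3 ≠ y)
    (hst : x.1 = y.1 ∨ x.2 = y.2)
    (hx : x ∉ (p :: r1 :: m1) ++ l2 ++ (p :: r3 :: m3))
    (hy : y ∉ (p :: r1 :: m1) ++ l2 ++ (p :: r3 :: m3)) :
    ∃ g : ℤ × ℤ → ZMod 2,
      (∀ a b, GridStep a b → a ∉ (p :: r1 :: m1) ++ l2 ++ (p :: r3 :: m3) →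
        b ∉ (p :: r1 :: m1) ++ l2 ++ (p :: r3 :: m3) → g a = g b) ∧ g x ≠ g y := by
  obtain ⟨g, gh, gv⟩ := exists_pot _ _ _ p q1 q2 c1 c2 c3 (by simp) h1' h2 h2' (by simp) h3'
  have H : ∀ v, v ∉ (p :: r1 :: m1) ++ l2 ++ (p :: r3 :: m3) →
      g v = g (v.1, v.2 - 1) ∧ g v = g (v.1 - 1, v.2) := by
    rintro ⟨v1, v2⟩ hv
    simp only [List.mem_append, not_or] at hv
    constructor
    · have := gh v1 v2
      rw [es_zero _ _ (hE_zero _) _ hv.1.1, es_zero _ _ (hE_zero _) _ hv.1.2,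
        es_zero _ _ (hE_zero _) _ hv.2] at this
      simp only [add_zero] at this
      exact CharTwo.add_eq_zero.1 this
    · have := gv v1 v2
      rw [es_zero _ _ (vE_zero _) _ hv.1.1, es_zero _ _ (vE_zero _) _ hv.1.2,
        es_zero _ _ (vE_zero _) _ hv.2] at this
      simp only [add_zero] at this
      exact CharTwo.add_eq_zero.1 this
  refine ⟨g, pot_const _ g H, ?_⟩
  obtain ⟨Hx1, Hx2⟩ := H x hx
  obtain ⟨Hy1, Hy2⟩ := H y hy
  rw [List.isChain_cons_cons] at c1 c3
  have s1 := c1.1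
  have s3 := c3.1
  obtain ⟨p1, p2⟩ := p
  have ghp := gh p1 p2
  have gvp := gv p1 p2
  simp only [es] at ghp gvp
  rw [es_zero _ _ (hE_zero _) _ n1, es_zero _ _ (hE_zero _) _ n2,
        es_zero _ _ (hE_zero _) _ n3] at ghp
  rw [es_zero _ _ (vE_zero _) _ n1, es_zero _ _ (vE_zero _) _ n2,
        es_zero _ _ (vE_zero _) _ n3] at gvp
  obtain ⟨x1, x2⟩ := x
  obtain ⟨y1, y2⟩ := y
  obtain ⟨a1, a2⟩ := r1
  obtain ⟨b1, b2⟩ := r3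
  simp only [ne_eq, Prod.mk.injEq] at hr hr1x hr1y hr3x hr3y xy
  simp only [GridStep] at s1 s3 sx sy
  simp only at hst Hx1 Hx2 Hy1 Hy2
  have key : ∀ u v : ZMod 2, u + v = 1 → u ≠ v := by decide
  by_cases hx1 : x1 = y1
  · -- vertical crossing
    have hh : hE (p1, p2) (p1, p2) (a1, a2) + hE (p1, p2) (p1, p2) (b1, b2) = 1 := by
      have := arith_cross p1 p2 x1 x2 y1 y2 a1 a2 b1 b2 sx sy s1 s3 hx1 xy hr1x hr1y hr3x hr3y hr
      rcases this with ⟨rfl, rfl, rfl, rfl⟩ | ⟨rfl, rfl, rfl, rfl⟩ <;> simp [hE] <;> omega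
    have e : g (p1, p2) + g (p1, p2 - 1) = 1 := by rw [ghp, ← hh]; ring
    have e' := key _ _ e
    have : (x1 = p1 ∧ x2 = p2 - 1 ∧ y1 = p1 ∧ p2 = y2 - 1) ∨
        (y1 = p1 ∧ y2 = p2 - 1 ∧ x1 = p1 ∧ p2 = x2 - 1) := by
      clear * - sx sy xy hx1
      omega
    rcases this with ⟨rfl, rfl, rfl, rfl⟩ | ⟨rfl, rfl, rfl, rfl⟩
    · rw [Hy1]; exact e'.symm
    · rw [Hx1]; exact e'
  · have hx2 : x2 = y2 := hst.resolve_left hx1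
    have hh : vE (p1, p2) (p1, p2) (a1, a2) + vE (p1, p2) (p1, p2) (b1, b2) = 1 := by
      have := arith_cross p2 p1 x2 x1 y2 y1 a2 a1 b2 b1
        (by rw [add_comm]; exact sx) (by rw [add_comm]; exact sy) (by rw [add_comm]; exact s1)
        (by rw [add_comm]; exact s3) hx2 (fun h => xy ⟨h.2, h.1⟩) (fun h => hr1x ⟨h.2, h.1⟩)
        (fun h => hr1y ⟨h.2, h.1⟩) (fun h => hr3x ⟨h.2, h.1⟩) (fun h => hr3y ⟨h.2, h.1⟩)
        (fun h => hr ⟨h.2, h.1⟩)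
      rcases this with ⟨rfl, rfl, rfl, rfl⟩ | ⟨rfl, rfl, rfl, rfl⟩ <;> simp [vE] <;> omega
    have e : g (p1, p2) + g (p1 - 1, p2) = 1 := by rw [gvp, ← hh]; ring
    have e' := key _ _ e
    have : (x2 = p2 ∧ x1 = p1 - 1 ∧ y2 = p2 ∧ p1 = y1 - 1) ∨
        (y2 = p2 ∧ y1 = p1 - 1 ∧ x2 = p2 ∧ p1 = x1 - 1) := by
      clear * - sx sy xy hx2
      omega
    rcases this with ⟨rfl, rfl, rfl, rfl⟩ | ⟨rfl, rfl, rfl, rfl⟩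
    · rw [Hy2]; exact e'.symm
    · rw [Hx2]; exact e'

theorem gridStep_symm {a b : ℤ × ℤ} (h : GridStep a b) : GridStep b a := by
  unfold GridStep at *; omega

theorem exists_walk : ∀ (l : List (ℤ × ℤ)), l.IsChain GridStep → ∀ q1 ∈ l, ∀ q2 ∈ l,
    ∃ w : List (ℤ × ℤ), w.IsChain GridStep ∧ (∀ z ∈ w, z ∈ l) ∧
      w.head? = some q1 ∧ w.getLast? = some q2
  | [], _, _, h, _, _ => by simp at h
  | [a], _, q1, h1, q2, h2 => by
    simp at h1 h2
    subst h1; subst h2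
    exact ⟨[q2], by simp, by simp, by simp, by simp⟩
  | a :: b :: l, h, q1, h1, q2, h2 => by
    rw [List.isChain_cons_cons] at h
    have ih := exists_walk (b :: l) h.2
    rw [List.mem_cons] at h1 h2
    rcases h1 with rfl | h1 <;> rcases h2 with rfl | h2
    · exact ⟨[q2], by simp, by simp, by simp, by simp⟩
    · obtain ⟨w, wc, ws, wh, wl⟩ := ih b (by simp) q2 h2
      cases w with
      | nil => simp at wh
      | cons c w =>
        simp at wh; subst wh
        refine ⟨q1 :: c :: w, ?_, ?_, by simp, ?_⟩
        · rw [List.isChain_cons_cons]; exact ⟨h.1, wc⟩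
        · intro z hz
          rcases List.mem_cons.1 hz with rfl | hz
          · simp
          · exact List.mem_cons_of_mem _ (ws z hz)
        · simpa using wl
    · obtain ⟨w, wc, ws, wh, wl⟩ := ih b (by simp) q1 h1
      cases w with
      | nil => simp at wh
      | cons c w =>
        simp at wh; subst wh
        refine ⟨(q2 :: c :: w).reverse, ?_, ?_, ?_, by simp⟩
        · rw [List.isChain_reverse]
          have : (q2 :: c :: w).IsChain GridStep := by
            rw [List.isChain_cons_cons]; exact ⟨h.1, wc⟩
          exact this.imp (fun _ _ => gridStep_symm)
        · intro z hz
          rw [List.mem_reverse] at hz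
          rcases List.mem_cons.1 hz with rfl | hz
          · simp
          · exact List.mem_cons_of_mem _ (ws z hz)
        · rw [List.head?_reverse]; simpa using wl
    · obtain ⟨w, wc, ws, wh, wl⟩ := ih q1 h1 q2 h2
      exact ⟨w, wc, fun z hz => List.mem_cons_of_mem _ (ws z hz), wh, wl⟩

theorem pot_list (g : ℤ × ℤ → ZMod 2) (S : Set (ℤ × ℤ))
    (H : ∀ a b, GridStep a b → a ∈ S → b ∈ S → g a = g b)
    (l : List (ℤ × ℤ)) (hc : l.IsChain GridStep) (hS : ∀ z ∈ l, z ∈ S)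
    (a b : ℤ × ℤ) (ha : a ∈ l) (hb : b ∈ l) : g a = g b := by
  suffices ∀ l : List (ℤ × ℤ), l.IsChain GridStep → (∀ z ∈ l, z ∈ S) → ∃ c, ∀ z ∈ l, g z = c by
    obtain ⟨c, hc⟩ := this l hc hS
    rw [hc a ha, hc b hb]
  intro l
  induction l with
  | nil => intro _ _; exact ⟨0, by simp⟩
  | cons a l ih =>
    intro hc hS
    cases l with
    | nil => exact ⟨g a, by simp⟩
    | cons b l =>
      rw [List.isChain_cons_cons] at hc
      obtain ⟨c, h⟩ := ih hc.2 (fun z hz => hS z (List.mem_cons_of_mem _ hz))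
      refine ⟨c, fun z hz => ?_⟩
      rcases List.mem_cons.1 hz with rfl | hz
      · rw [H z b hc.1 (hS z (by simp)) (hS b (by simp))]
        exact h b (by simp)
      · exact h z hz

end GkProof
/-! ### Part B: a contact of two sewing paths on a pure path is a bend -/

namespace GkProof

theorem mem_toSet {P : GridPath} {p : ℤ × ℤ} : p ∈ P.toSet ↔ p ∈ P.pts := Iff.rfl

theorem chain (P : GridPath) : P.pts.IsChain GridStep := P.step

theorem first_mem (P : GridPath) : P.first ∈ P.toSet := List.head_mem _
theorem last_mem (P : GridPath) : P.last ∈ P.toSet := List.getLast_mem _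

theorem first_ne_last (P : GridPath) : P.first ≠ P.last := by
  obtain ⟨l, h2, hs, hn⟩ := P
  simp only [GridPath.first, GridPath.last]
  match l, h2, hn with
  | a :: b :: l, _, hn =>
    intro h
    simp only [List.head_cons, List.getLast_cons_cons] at h
    rw [List.nodup_cons] at hn
    apply hn.1
    rw [h]
    exact List.getLast_mem _

theorem endpoint_mem {P : GridPath} {p : ℤ × ℤ} (h : P.IsEndpoint p) : p ∈ P.toSet := by
  rcases h with rfl | rfl
  · exact first_mem P
  · exact last_mem P

/-- From an endpoint, the path can be written as a list starting there. -/
theorem from_endpoint (P : GridPath) (p q : ℤ × ℤ) (hp : P.IsEndpoint p) (hq : P.IsEndpoint q)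
    (hpq : p ≠ q) : ∃ r m, (p :: r :: m).IsChain GridStep ∧ p ∉ r :: m ∧
      (∀ z, z ∈ p :: r :: m ↔ z ∈ P.toSet) ∧ (p :: r :: m).getLast? = some q ∧
      ConsecIn P.pts p r := by
  have h2 := P.two_le_length
  have hs := chain P
  have hn := P.nodup
  by_cases hf : p = P.first
  · have hl : q = P.last := by
      rcases hq with h | h
      · exact absurd (hf.trans h.symm) hpq
      · exact h
    obtain ⟨l, h2', hs', hn'⟩ := P
    simp only [GridPath.first, GridPath.last] at *
    match l with
    | [] => simp at h2
    | [a] => simp at h2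
    | a :: b :: l =>
      simp only [List.head_cons] at hf
      subst hf
      refine ⟨b, l, hs, (List.nodup_cons.1 hn).1, fun z => Iff.rfl, ?_, ?_⟩
      · rw [hl]; exact List.getLast?_eq_some_getLast _
      · left; exact ⟨[], l, by simp⟩
  · have hl : p = P.last := by
      rcases hp with h | h
      · exact absurd h hf
      · exact h
    have hq' : q = P.first := by
      rcases hq with h | h
      · exact h
      · exact absurd (hl.trans h.symm) hpq
    obtain ⟨l, h2', hs', hn'⟩ := P
    simp only [GridPath.first, GridPath.last] at *
    have hs2 : l.reverse.IsChain GridStep := by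
      rw [List.isChain_reverse]
      exact hs.imp (fun _ _ => gridStep_symm)
    have hn2 : l.reverse.Nodup := List.nodup_reverse.2 hn
    have e1 : l.reverse.head? = some p := by
      rw [List.head?_reverse, hl]; exact List.getLast?_eq_some_getLast _
    have e2 : l.reverse.getLast? = some q := by
      rw [List.getLast?_reverse, hq']; exact List.head?_eq_some_head _
    have e3 : 2 ≤ l.reverse.length := by simpa using h2
    have e4 : ∀ z, z ∈ l.reverse ↔ z ∈ l := fun z => List.mem_reverse
    generalize hL : l.reverse = L at *
    match L with
    | [] => simp at e3
    | [a] => simp at e3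
    | a :: b :: L =>
      simp only [List.head?_cons, Option.some.injEq] at e1
      subst e1
      refine ⟨b, L, hs2, (List.nodup_cons.1 hn2).1, fun z => e4 z, e2, ?_⟩
      right
      have : l = (a :: b :: L).reverse := by rw [← hL, List.reverse_reverse]
      refine ⟨L.reverse, [], ?_⟩
      rw [this]; simp

/-- An interior point has a predecessor and a successor. -/
theorem interior_split (P : GridPath) (p : ℤ × ℤ) (hp : p ∈ P.toSet) (he : ¬ P.IsEndpoint p) :
    ∃ s x y t, P.pts = s ++ x :: p :: y :: t := by
  obtain ⟨s, t, h⟩ := List.append_of_mem (mem_toSet.1 hp)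
  have hs : s ≠ [] := by
    rintro rfl
    apply he; left
    simp [GridPath.first, h]
  have ht : t ≠ [] := by
    rintro rfl
    apply he; right
    simp [GridPath.last, h]
  obtain ⟨s', x, rfl⟩ := List.eq_nil_or_concat s |>.resolve_left hs
  obtain ⟨y, t', rfl⟩ := List.exists_cons_of_ne_nil ht
  exact ⟨s', x, y, t', by rw [h]; simp⟩

/-- The open part of a grid path. -/
theorem exists_inner (P : GridPath) : ∃ l : List (ℤ × ℤ), l.IsChain GridStep ∧
    ∀ z, z ∈ l ↔ z ∈ P.toSet ∧ ¬ P.IsEndpoint z := by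
  have hs := chain P
  have hn := P.nodup
  have e : ∃ l, P.pts = P.first :: l ++ [P.last] := by
    have hne := first_ne_last P
    obtain ⟨l, h2', hs', hn'⟩ := P
    simp only [GridPath.first, GridPath.last] at *
    match l with
    | [] => simp at h2'
    | [a] => simp at h2'
    | a :: b :: l =>
      refine ⟨(b :: l).dropLast, ?_⟩
      simp only [List.head_cons, List.cons_append]
      rw [List.getLast_cons_cons, List.dropLast_append_getLast]
  obtain ⟨l, e⟩ := e
  refine ⟨l, ?_, fun z => ?_⟩
  · rw [e] at hs
    have := (List.isChain_append.1 hs).1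
    exact this.tail
  · rw [mem_toSet, e]
    rw [e] at hn
    simp only [GridPath.IsEndpoint]
    simp only [List.cons_append, List.nodup_cons, List.mem_append, List.mem_singleton, not_or,
      List.nodup_append] at hn
    simp only [List.cons_append, List.mem_cons, List.mem_append, List.not_mem_nil, or_false]
    constructor
    · intro hz
      refine ⟨Or.inr (Or.inl hz), ?_⟩
      rintro (rfl | rfl)
      · exact hn.1.1 hz
      · exact hn.2.2.2 _ hz _ rfl rfl
    · rintro ⟨h | h | h, h'⟩
      · exact absurd (Or.inl h) h'
      · exact h
      · exact absurd (Or.inr h) h'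

theorem consec_symm {l : List (ℤ × ℤ)} {p q} (h : ConsecIn l p q) : ConsecIn l q p := Or.symm h

/-- The geometric heart: the common endpoint of `W` and `W'` on `V` is a bend of `V`. -/
theorem bend_of_contact (A B V V' W W' : GridPath) (p q q' : ℤ × ℤ)
    (hAB : ∃ z, z ∈ A.toSet ∧ z ∈ B.toSet)
    (hV : (V.first ∈ A.toSet ∧ V.last ∈ B.toSet) ∨ (V.first ∈ B.toSet ∧ V.last ∈ A.toSet))
    (hAW : ∀ z, z ∈ A.toSet → z ∉ W.toSet) (hAW' : ∀ z, z ∈ A.toSet → z ∉ W'.toSet)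
    (hBW : ∀ z, z ∈ B.toSet → z ∉ W.toSet) (hBW' : ∀ z, z ∈ B.toSet → z ∉ W'.toSet)
    (hVV' : ∀ z, z ∈ V.toSet → z ∉ V'.toSet)
    (hAV' : ∀ z, z ∈ A.toSet → z ∈ V'.toSet → V'.IsEndpoint z)
    (hBV' : ∀ z, z ∈ B.toSet → z ∈ V'.toSet → V'.IsEndpoint z)
    (hp : p ∈ V.toSet) (hpV : ¬ V.IsEndpoint p)
    (hpW : W.IsEndpoint p) (hpW' : W'.IsEndpoint p)
    (hqW : W.IsEndpoint q) (hqW' : W'.IsEndpoint q')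
    (hqV : q ∈ V'.toSet) (hqV' : q' ∈ V'.toSet)
    (hqe : ¬ V'.IsEndpoint q) (hqe' : ¬ V'.IsEndpoint q')
    (hVW : ∀ z, z ∈ V.toSet → z ∈ W.toSet → z = p)
    (hVW' : ∀ z, z ∈ V.toSet → z ∈ W'.toSet → z = p)
    (nVW : ∀ a b, ConsecIn V.pts a b → ¬ ConsecIn W.pts a b)
    (nVW' : ∀ a b, ConsecIn V.pts a b → ¬ ConsecIn W'.pts a b)
    (nWW' : ∀ a b, ConsecIn W.pts a b → ¬ ConsecIn W'.pts a b) :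
    V.IsBend p := by
  obtain ⟨s, x, y, t, hV0⟩ := interior_split V p hp hpV
  by_contra hb
  have hst : x.1 = y.1 ∨ x.2 = y.2 := by
    by_contra hcon
    rw [not_or] at hcon
    exact hb ⟨x, y, ⟨s, t, by rw [hV0]; simp⟩, hcon.1, hcon.2⟩
  have hpq : p ≠ q := fun h => hVV' p hp (h ▸ hqV)
  have hpq' : p ≠ q' := fun h => hVV' p hp (h ▸ hqV')
  obtain ⟨r1, m1, c1, n1, s1, g1, e1⟩ := from_endpoint W p q hpW hqW hpq
  obtain ⟨r3, m3, c3, n3, s3, g3, e3⟩ := from_endpoint W' p q' hpW' hqW' hpq'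
  obtain ⟨lI, cI, sI⟩ := exists_inner V'
  obtain ⟨l2, c2, s2, h2, h2'⟩ := exists_walk lI cI q ((sI q).2 ⟨hqV, hqe⟩) q'
    ((sI q').2 ⟨hqV', hqe'⟩)
  have hc := chain V
  have hnd := V.nodup
  rw [hV0] at hc hnd
  have cx : ConsecIn V.pts x p := Or.inl ⟨s, y :: t, by rw [hV0]; simp⟩
  have cy : ConsecIn V.pts p y := Or.inl ⟨s ++ [x], t, by rw [hV0]; simp⟩
  have hc2 := (List.isChain_append.1 hc).2.1
  rw [List.isChain_cons_cons, List.isChain_cons_cons] at hc2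
  have hc1 : (s ++ [x]).IsChain GridStep := by
    have : (s ++ [x] ++ (p :: y :: t)).IsChain GridStep := by simpa using hc
    exact (List.isChain_append.1 this).1
  have mV : ∀ z, z ∈ V.toSet ↔ z ∈ s ++ [x] ∨ z = p ∨ z ∈ y :: t := by
    intro z
    rw [mem_toSet, hV0]
    simp only [List.mem_append, List.mem_cons, List.not_mem_nil, or_false, or_assoc]
  have pS : p ∉ s ++ [x] ∧ p ∉ y :: t := by
    have : (s ++ [x] ++ (p :: y :: t)).Nodup := by simpa using hnd
    rw [List.nodup_append] at this
    refine ⟨fun h => this.2.2 p h p (by simp) rfl, (List.nodup_cons.1 this.2.1).1⟩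
  have xS : x ∈ s ++ [x] := by simp
  have yS : y ∈ y :: t := by simp
  have hxy : x ≠ y := by
    have : (s ++ [x] ++ (p :: y :: t)).Nodup := by simpa using hnd
    rw [List.nodup_append] at this
    exact fun h => this.2.2 x xS y (by simp) h
  have n2 : ∀ z, z ∈ V.toSet → z ∉ l2 := fun z hz hz' =>
    hVV' z hz ((sI z).1 (s2 z hz')).1
  have avV : ∀ z, z ∈ V.toSet → z ≠ p → z ∉ (p :: r1 :: m1) ++ l2 ++ (p :: r3 :: m3) := by
    intro z hz hzp hm
    rw [List.mem_append, List.mem_append] at hm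
    rcases hm with (hm | hm) | hm
    · exact hzp (hVW z hz ((s1 z).1 hm))
    · exact n2 z hz hm
    · exact hzp (hVW' z hz ((s3 z).1 hm))
  have av1 : ∀ z ∈ s ++ [x], z ∉ (p :: r1 :: m1) ++ l2 ++ (p :: r3 :: m3) :=
    fun z hz => avV z ((mV z).2 (Or.inl hz)) (fun h => pS.1 (h ▸ hz))
  have av2 : ∀ z ∈ y :: t, z ∉ (p :: r1 :: m1) ++ l2 ++ (p :: r3 :: m3) :=
    fun z hz => avV z ((mV z).2 (Or.inr (Or.inr hz))) (fun h => pS.2 (h ▸ hz))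
  have avA : ∀ z ∈ A.pts, z ∉ (p :: r1 :: m1) ++ l2 ++ (p :: r3 :: m3) := by
    intro z hz hm
    rw [List.mem_append, List.mem_append] at hm
    rcases hm with (hm | hm) | hm
    · exact hAW z hz ((s1 z).1 hm)
    · have := (sI z).1 (s2 z hm)
      exact this.2 (hAV' z hz this.1)
    · exact hAW' z hz ((s3 z).1 hm)
  have avB : ∀ z ∈ B.pts, z ∉ (p :: r1 :: m1) ++ l2 ++ (p :: r3 :: m3) := by
    intro z hz hm
    rw [List.mem_append, List.mem_append] at hm
    rcases hm with (hm | hm) | hm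
    · exact hBW z hz ((s1 z).1 hm)
    · have := (sI z).1 (s2 z hm)
      exact this.2 (hBV' z hz this.1)
    · exact hBW' z hz ((s3 z).1 hm)
  obtain ⟨g, G, gxy⟩ := straight_pot x p y r1 r3 q q' m1 m3 l2 c1 c2 c3 g1 h2 h2' g3 n1 n3
    (n2 p hp) hc2.1 hc2.2.1 hxy
    (fun h => nWW' p r1 e1 (h ▸ e3))
    (fun h => nVW p x (consec_symm cx) (h ▸ e1))
    (fun h => nVW p y cy (h ▸ e1))
    (fun h => nVW' p x (consec_symm cx) (h ▸ e3))
    (fun h => nVW' p y cy (h ▸ e3)) hst (av1 x xS) (av2 y yS)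
  apply gxy
  have pl := pot_list g {z | z ∉ (p :: r1 :: m1) ++ l2 ++ (p :: r3 :: m3)} G
  have f1 : V.first ∈ s ++ [x] := by
    have : V.first = (s ++ [x]).head (by simp) := by
      simp only [GridPath.first, hV0]
      cases s <;> simp
    rw [this]; exact List.head_mem _
  have f2 : V.last ∈ y :: t := by
    have : V.last = (y :: t).getLast (by simp) := by
      simp only [GridPath.last, hV0]
      rw [List.getLast_append_of_ne_nil _ (by simp), List.getLast_cons_cons, List.getLast_cons_cons]
    rw [this]; exact List.getLast_mem _
  have k1 := pl _ hc1 av1 x V.first xS f1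
  have k2 := pl _ hc2.2.2 av2 V.last y f2 yS
  obtain ⟨z, hzA, hzB⟩ := hAB
  rw [k1, ← k2]
  rcases hV with ⟨ha, hb⟩ | ⟨hb, ha⟩
  · rw [pl _ (chain A) avA V.first z ha hzA, pl _ (chain B) avB z V.last hzB hb]
  · rw [pl _ (chain B) avB V.first z hb hzB, pl _ (chain A) avA z V.last hzA ha]

end GkProof
/-! ### Part C: the counting argument -/

namespace GkProof

variable {k : ℕ}

theorem adj_ab : (Gk k).Adj GkV.a GkV.b := by
  rw [Gk, SimpleGraph.fromRel_adj]; exact ⟨by simp, Or.inl GkRel.ab⟩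
theorem adj_aα (i : Fin 20) : (Gk k).Adj GkV.a (GkV.α i) := by
  rw [Gk, SimpleGraph.fromRel_adj]; exact ⟨by simp, Or.inl (GkRel.aα i)⟩
theorem adj_bα (i : Fin 20) : (Gk k).Adj GkV.b (GkV.α i) := by
  rw [Gk, SimpleGraph.fromRel_adj]; exact ⟨by simp, Or.inl (GkRel.bα i)⟩
theorem nadj_au (i : Fin 19) (j : Fin (k + 2)) : ¬ (Gk k).Adj GkV.a (GkV.u i j) := by
  rw [Gk, SimpleGraph.fromRel_adj]; rintro ⟨_, h | h⟩ <;> cases h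
theorem nadj_bu (i : Fin 19) (j : Fin (k + 2)) : ¬ (Gk k).Adj GkV.b (GkV.u i j) := by
  rw [Gk, SimpleGraph.fromRel_adj]; rintro ⟨_, h | h⟩ <;> cases h
theorem nadj_αα (i j : Fin 20) : ¬ (Gk k).Adj (GkV.α i) (GkV.α j) := by
  rw [Gk, SimpleGraph.fromRel_adj]; rintro ⟨_, h | h⟩ <;> cases h
theorem adj_αu (i : Fin 20) (i' : Fin 19) (j : Fin (k + 2)) :
    (Gk k).Adj (GkV.α i) (GkV.u i' j) ↔ (i : ℕ) = i' ∨ (i : ℕ) = i' + 1 := by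
  rw [Gk, SimpleGraph.fromRel_adj]
  constructor
  · rintro ⟨_, h | h⟩ <;> cases h <;> simp
  · intro h
    refine ⟨by simp, Or.inl ?_⟩
    rcases h with h | h
    · have : i = i'.castSucc := Fin.ext h
      subst this; exact GkRel.αu _ _
    · have : i = i'.succ := Fin.ext h
      subst this; exact GkRel.α'u _ _
theorem adj_uu (i i' : Fin 19) (j j' : Fin (k + 2)) :
    (Gk k).Adj (GkV.u i j) (GkV.u i' j') ↔
      i = i' ∧ ((j : ℕ) + 1 = j' ∨ (j' : ℕ) + 1 = j) := by
  rw [Gk, SimpleGraph.fromRel_adj]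
  constructor
  · rintro ⟨_, h | h⟩ <;> cases h
    · rename_i h; exact ⟨rfl, Or.inl h⟩
    · rename_i h; exact ⟨rfl, Or.inr h⟩
  · rintro ⟨rfl, h | h⟩
    · refine ⟨?_, Or.inl (GkRel.uu _ _ _ h)⟩
      rintro h'; cases h'; omega
    · refine ⟨?_, Or.inr (GkRel.uu _ _ _ h)⟩
      rintro h'; cases h'; omega

variable (R : CPGRep (Gk k))

theorem disj {u v : GkV k} (huv : u ≠ v) (h : ¬ (Gk k).Adj u v) (z : ℤ × ℤ)
    (hz : z ∈ (R.path u).toSet) : z ∉ (R.path v).toSet :=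
  fun hz' => h ((R.adj_iff u v huv).2 ⟨z, hz, hz'⟩)

theorem αα_disj {i j : Fin 20} (h : i ≠ j) (z : ℤ × ℤ)
    (hz : z ∈ (R.path (GkV.α i)).toSet) : z ∉ (R.path (GkV.α j)).toSet :=
  disj R (by simpa using h) (nadj_αα i j) z hz

theorem pure_a {i : Fin 20} (h : IsPure R (GkV.α i)) (z : ℤ × ℤ)
    (hz : z ∈ (R.path GkV.a).toSet) (hz' : z ∈ (R.path (GkV.α i)).toSet) :
    (R.path (GkV.α i)).IsEndpoint z := by
  rcases R.interiorly_disjoint _ _ (by simp) z hz hz' with e | e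
  · exact absurd hz' (h z (Or.inl e))
  · exact e

theorem pure_b {i : Fin 20} (h : IsPure R (GkV.α i)) (z : ℤ × ℤ)
    (hz : z ∈ (R.path GkV.b).toSet) (hz' : z ∈ (R.path (GkV.α i)).toSet) :
    (R.path (GkV.α i)).IsEndpoint z := by
  rcases R.interiorly_disjoint _ _ (by simp) z hz hz' with e | e
  · exact absurd hz' (h z (Or.inr e))
  · exact e

theorem pure_ends {i : Fin 20} (h : IsPure R (GkV.α i)) :
    ((R.path (GkV.α i)).first ∈ (R.path GkV.a).toSet ∧
      (R.path (GkV.α i)).last ∈ (R.path GkV.b).toSet) ∨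
    ((R.path (GkV.α i)).first ∈ (R.path GkV.b).toSet ∧
      (R.path (GkV.α i)).last ∈ (R.path GkV.a).toSet) := by
  obtain ⟨x, xa, xα⟩ := (R.adj_iff _ _ (by simp)).1 (adj_aα (k := k) i)
  obtain ⟨y, yb, yα⟩ := (R.adj_iff _ _ (by simp)).1 (adj_bα (k := k) i)
  have xy : x ≠ y := by
    rintro rfl
    rcases R.interiorly_disjoint _ _ (by simp) x xa yb with e | e
    · exact h x (Or.inl e) xα
    · exact h x (Or.inr e) xα
  have ex := pure_a R h x xa xα
  have ey := pure_b R h y yb yα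
  rcases ex with ex | ex <;> rcases ey with ey | ey
  · exact absurd (ex.trans ey.symm) xy
  · left; rw [← ex, ← ey]; exact ⟨xa, yb⟩
  · right; rw [← ex, ← ey]; exact ⟨yb, xa⟩
  · exact absurd (ex.trans ey.symm) xy

theorem au_disj (i : Fin 19) (j : Fin (k + 2)) (z : ℤ × ℤ)
    (hz : z ∈ (R.path GkV.a).toSet) : z ∉ (R.path (GkV.u i j)).toSet :=
  disj R (by simp) (nadj_au i j) z hz
theorem bu_disj (i : Fin 19) (j : Fin (k + 2)) (z : ℤ × ℤ)
    (hz : z ∈ (R.path GkV.b).toSet) : z ∉ (R.path (GkV.u i j)).toSet :=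
  disj R (by simp) (nadj_bu i j) z hz

theorem pure_u {l : Fin 20} (h : IsPure R (GkV.α l)) (i : Fin 19) (j : Fin (k + 2)) (z : ℤ × ℤ)
    (hz : z ∈ (R.path (GkV.α l)).toSet) (hz' : z ∈ (R.path (GkV.u i j)).toSet) :
    (R.path (GkV.u i j)).IsEndpoint z ∧ ¬ (R.path (GkV.α l)).IsEndpoint z := by
  have ne : ¬ (R.path (GkV.α l)).IsEndpoint z := by
    intro e
    rcases pure_ends R h with ⟨h1, h2⟩ | ⟨h1, h2⟩ <;> rcases e with rfl | rfl
    · exact au_disj R i j _ h1 hz'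
    · exact bu_disj R i j _ h2 hz'
    · exact bu_disj R i j _ h1 hz'
    · exact au_disj R i j _ h2 hz'
  rcases R.interiorly_disjoint _ _ (by simp) z hz hz' with e | e
  · exact absurd e ne
  · exact ⟨e, ne⟩

/-- contact of `α_l` and `u^i_j` -/
theorem contact_u {l : Fin 20} (h : IsPure R (GkV.α l)) (i : Fin 19) (j : Fin (k + 2))
    (hl : (l : ℕ) = i ∨ (l : ℕ) = i + 1) :
    ∃ z, z ∈ (R.path (GkV.α l)).toSet ∧ (R.path (GkV.u i j)).IsEndpoint z ∧
      ¬ (R.path (GkV.α l)).IsEndpoint z := by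
  obtain ⟨z, z1, z2⟩ := (R.adj_iff _ _ (by simp)).1 ((adj_αu (k := k) l i j).2 hl)
  exact ⟨z, z1, pure_u R h i j z z1 z2⟩

theorem end_cases (P : GridPath) (x y z : ℤ × ℤ) (hx : P.IsEndpoint x) (hy : P.IsEndpoint y)
    (hz : P.IsEndpoint z) (hxy : x ≠ y) : z = x ∨ z = y := by
  rcases hx with rfl | rfl <;> rcases hy with rfl | rfl <;> rcases hz with rfl | rfl <;> simp_all

/-- The data attached to the common point of `u^i_j` and `u^i_{j+1}`, relative to two pure
neighbours `α_l`, `α_l'`. -/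
theorem contact_bend {i : Fin 19} {l l' : Fin 20} (hl : IsPure R (GkV.α l))
    (hl' : IsPure R (GkV.α l')) (hne : l ≠ l')
    (e : (l : ℕ) = i ∨ (l : ℕ) = i + 1) (e' : (l' : ℕ) = i ∨ (l' : ℕ) = i + 1)
    (j j' : Fin (k + 2)) (hjj : j ≠ j') (p : ℤ × ℤ)
    (hp : p ∈ (R.path (GkV.u i j)).toSet) (hp' : p ∈ (R.path (GkV.u i j')).toSet)
    (hpl : p ∈ (R.path (GkV.α l)).toSet) : (R.path (GkV.α l)).IsBend p := by
  obtain ⟨q, q1, q2, q3⟩ := contact_u R hl' i j e'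
  obtain ⟨q', q1', q2', q3'⟩ := contact_u R hl' i j' e'
  have hpW := pure_u R hl i j p hpl hp
  have hpW' := pure_u R hl i j' p hpl hp'
  have hpq : p ≠ q := fun h => αα_disj R hne p hpl (h ▸ q1)
  have hpq' : p ≠ q' := fun h => αα_disj R hne p hpl (h ▸ q1')
  refine bend_of_contact (R.path GkV.a) (R.path GkV.b) (R.path (GkV.α l)) (R.path (GkV.α l'))
    (R.path (GkV.u i j)) (R.path (GkV.u i j')) p q q'
    ((R.adj_iff _ _ (by simp)).1 adj_ab) (pure_ends R hl) (au_disj R i j) (au_disj R i j')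
    (bu_disj R i j) (bu_disj R i j') (αα_disj R hne) (pure_a R hl') (pure_b R hl') hpl hpW.2
    hpW.1 hpW'.1 q2 q2' q1 q1' q3 q3' ?_ ?_ (R.no_shared_segment _ _ (by simp))
    (R.no_shared_segment _ _ (by simp)) (R.no_shared_segment _ _ (by simpa using hjj))
  · intro z hz hz'
    rcases end_cases _ p q z hpW.1 q2 (pure_u R hl i j z hz hz').1 hpq with h | h
    · exact h
    · exact absurd (h ▸ q1) (αα_disj R hne z hz)
  · intro z hz hz'
    rcases end_cases _ p q' z hpW'.1 q2' (pure_u R hl i j' z hz hz').1 hpq' with h | h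
    · exact h
    · exact absurd (h ▸ q1') (αα_disj R hne z hz)

/-- Common point of consecutive sewing paths lies on one of the two pure paths. -/
theorem exists_contact {i : Fin 19} {l l' : Fin 20} (hl : IsPure R (GkV.α l))
    (hl' : IsPure R (GkV.α l')) (hne : l ≠ l')
    (e : (l : ℕ) = i ∨ (l : ℕ) = i + 1) (e' : (l' : ℕ) = i ∨ (l' : ℕ) = i + 1)
    (j j' : Fin (k + 2)) (hjj : (j : ℕ) + 1 = j') :
    ∃ p, p ∈ (R.path (GkV.u i j)).toSet ∧ p ∈ (R.path (GkV.u i j')).toSet ∧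
      (p ∈ (R.path (GkV.α l)).toSet ∨ p ∈ (R.path (GkV.α l')).toSet) := by
  have hne' : GkV.u i j ≠ GkV.u i j' := by
    intro h; cases h; omega
  obtain ⟨p, p1, p2⟩ := (R.adj_iff _ _ hne').1 ((adj_uu i i j j').2 ⟨rfl, Or.inl hjj⟩)
  refine ⟨p, p1, p2, ?_⟩
  have key : ∀ j, (R.path (GkV.u i j)).IsEndpoint p →
      (p ∈ (R.path (GkV.α l)).toSet ∨ p ∈ (R.path (GkV.α l')).toSet) := by
    intro j hj
    obtain ⟨q, q1, q2, q3⟩ := contact_u R hl i j e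
    obtain ⟨q', q1', q2', q3'⟩ := contact_u R hl' i j e'
    have : q ≠ q' := fun h => αα_disj R hne q q1 (h ▸ q1')
    rcases end_cases _ q q' p q2 q2' hj this with h | h
    · left; rw [h]; exact q1
    · right; rw [h]; exact q1'
  rcases R.interiorly_disjoint _ _ hne' p p1 p2 with h | h
  · exact key _ h
  · exact key _ h

theorem not_adj_points {i : Fin 19} (j j' : ℕ) (hj : j + 1 < k + 2) (hj' : j' + 1 < k + 2)
    (hlt : j < j') (p : ℤ × ℤ)
    (h : p ∈ (R.path (GkV.u i ⟨j, by omega⟩)).toSet)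
    (h' : p ∈ (R.path (GkV.u i ⟨j' + 1, hj'⟩)).toSet) : False := by
  refine disj R (u := GkV.u i ⟨j, by omega⟩) (v := GkV.u i ⟨j' + 1, hj'⟩) ?_ ?_ p h h'
  · intro h; cases h; omega
  · rw [adj_uu]
    rintro ⟨_, h | h⟩ <;> simp at h <;> omega

/-- The sequence of contact points for a pure pair. -/
theorem exists_points {i : Fin 19} {l l' : Fin 20} (hl : IsPure R (GkV.α l))
    (hl' : IsPure R (GkV.α l')) (hne : l ≠ l')
    (e : (l : ℕ) = i ∨ (l : ℕ) = i + 1) (e' : (l' : ℕ) = i ∨ (l' : ℕ) = i + 1) :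
    ∃ f : ℕ → ℤ × ℤ,
      (∀ j, j < k + 1 → ∃ m, f j ∈ (R.path (GkV.u i m)).toSet) ∧
      (∀ j j', j < k + 1 → j' < k + 1 → f j = f j' → j = j') ∧
      (∀ j, j < k + 1 → (R.path (GkV.α l)).IsBend (f j) ∨ (R.path (GkV.α l')).IsBend (f j)) ∧
      (∀ j, j + 1 < k + 1 → (R.path (GkV.α l)).IsBend (f j) ∨
        (R.path (GkV.α l)).IsBend (f (j + 1))) := by
  have H : ∀ j : ℕ, ∃ p : ℤ × ℤ, ∀ hj : j + 1 < k + 2,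
      p ∈ (R.path (GkV.u i ⟨j, by omega⟩)).toSet ∧ p ∈ (R.path (GkV.u i ⟨j + 1, hj⟩)).toSet ∧
      (p ∈ (R.path (GkV.α l)).toSet ∨ p ∈ (R.path (GkV.α l')).toSet) := by
    intro j
    by_cases hj : j + 1 < k + 2
    · obtain ⟨p, hp⟩ := exists_contact R hl hl' hne e e' ⟨j, by omega⟩ ⟨j + 1, hj⟩ rfl
      exact ⟨p, fun _ => hp⟩
    · exact ⟨0, fun h => absurd h hj⟩
  choose f hf using H
  have inj : ∀ j j', j < k + 1 → j' < k + 1 → f j = f j' → j = j' := by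
    intro j j' hj hj' h
    rcases lt_trichotomy j j' with hlt | h' | hlt
    · exact (not_adj_points R j j' (by omega) (by omega) hlt (f j)
        (hf j (by omega)).1 (h ▸ (hf j' (by omega)).2.1)).elim
    · exact h'
    · exact (not_adj_points R j' j (by omega) (by omega) hlt (f j')
        (hf j' (by omega)).1 (h ▸ (hf j (by omega)).2.1)).elim
  refine ⟨f, fun j hj => ⟨_, (hf j (by omega)).1⟩, inj, ?_, ?_⟩
  · intro j hj
    obtain ⟨h1, h2, h3 | h3⟩ := hf j (by omega)
    · exact Or.inl (contact_bend R hl hl' hne e e' _ _ (by simp) _ h1 h2 h3)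
    · exact Or.inr (contact_bend R hl' hl hne.symm e' e _ _ (by simp) _ h1 h2 h3)
  · intro j hj
    obtain ⟨h1, h2, h3⟩ := hf j (by omega)
    obtain ⟨h1', h2', h3'⟩ := hf (j + 1) (by omega)
    rcases h3 with h3 | h3
    · exact Or.inl (contact_bend R hl hl' hne e e' _ _ (by simp) _ h1 h2 h3)
    rcases h3' with h3' | h3'
    · exact Or.inr (contact_bend R hl hl' hne e e' _ _ (by simp) _ h1' h2' h3')
    exfalso
    obtain ⟨q, q1, q2, q3⟩ := contact_u R hl i ⟨j + 1, by omega⟩ e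
    have hpp : f j ≠ f (j + 1) := fun h => by
      have := inj j (j + 1) (by omega) (by omega) h
      omega
    rcases end_cases _ _ _ q (pure_u R hl' _ _ _ h3 h2).1 (pure_u R hl' _ _ _ h3' h1').1 q2 hpp
      with h | h
    · exact αα_disj R hne q q1 (h ▸ h3)
    · exact αα_disj R hne q q1 (h ▸ h3')

theorem bend_mem {P : GridPath} {p : ℤ × ℤ} (h : P.IsBend p) : p ∈ P.toSet := by
  obtain ⟨a, c, h, _⟩ := h
  exact h.subset (by simp)

theorem bend_finite (P : GridPath) : P.bendSet.Finite :=
  (P.pts.finite_toSet).subset (fun _ h => bend_mem h)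

theorem exists_pure_block : ∃ b : ℕ, b < 5 ∧ ∀ r : ℕ, (hr : 4 * b + r < 20) → r < 4 →
    IsPure R (GkV.α ⟨4 * b + r, hr⟩) := by
  by_contra hcon
  push Not at hcon
  let e : Fin 4 → ℤ × ℤ := ![(R.path GkV.a).first, (R.path GkV.a).last, (R.path GkV.b).first,
    (R.path GkV.b).last]
  have H : ∀ b : Fin 5, ∃ c : Fin 4, ∃ r : ℕ, ∃ hr : 4 * (b : ℕ) + r < 20, r < 4 ∧
      e c ∈ (R.path (GkV.α ⟨4 * b + r, hr⟩)).toSet := by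
    intro b
    obtain ⟨r, hr, hr4, hp⟩ := hcon b b.2
    unfold IsPure at hp
    push Not at hp
    obtain ⟨p, hp, hm⟩ := hp
    rcases hp with (h | h) | (h | h)
    · subst h; exact ⟨0, r, hr, hr4, hm⟩
    · subst h; exact ⟨1, r, hr, hr4, hm⟩
    · subst h; exact ⟨2, r, hr, hr4, hm⟩
    · subst h; exact ⟨3, r, hr, hr4, hm⟩
  choose c r hr hr4 hm using H
  obtain ⟨b, b', hbb, hc⟩ := Fintype.exists_ne_map_eq_of_card_lt c (by simp)
  have hb := hr4 b
  have hb' := hr4 b'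
  refine αα_disj R ?_ _ (hm b) (hc ▸ hm b')
  intro h
  rw [Fin.mk.injEq] at h
  apply hbb
  ext
  omega

theorem not_Bk (k : ℕ) : ¬ IsBkCPG (Gk k) k := by
  rintro ⟨R, hR⟩
  obtain ⟨b, hb, hp⟩ := exists_pure_block R
  have h0 := hp 0 (by omega) (by omega)
  have h1 := hp 1 (by omega) (by omega)
  have h2 := hp 2 (by omega) (by omega)
  have h3 := hp 3 (by omega) (by omega)
  obtain ⟨f, fm, finj, fb, -⟩ := exists_points R (i := ⟨4 * b + 1, by omega⟩) h1 h2 (by simp)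
    (by simp) (by simp)
  obtain ⟨g, gm, ginj, -, gb⟩ := exists_points R (i := ⟨4 * b, by omega⟩) h1 h0 (by simp)
    (by simp) (by simp)
  obtain ⟨h, hm, hinj, -, hbd⟩ := exists_points R (i := ⟨4 * b + 2, by omega⟩) h2 h3 (by simp)
    (by simp) (by simp)
  have G : ∀ m : ℕ, ∃ j, m < (k + 1) / 2 → (j = 2 * m ∨ j = 2 * m + 1) ∧
      (R.path (GkV.α ⟨4 * b + 1, by omega⟩)).IsBend (g j) := by
    intro m
    by_cases hm : m < (k + 1) / 2
    · rcases gb (2 * m) (by omega) with h | h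
      · exact ⟨_, fun _ => ⟨Or.inl rfl, h⟩⟩
      · exact ⟨_, fun _ => ⟨Or.inr rfl, h⟩⟩
    · exact ⟨0, fun h => absurd h hm⟩
  have H : ∀ m : ℕ, ∃ j, m < (k + 1) / 2 → (j = 2 * m ∨ j = 2 * m + 1) ∧
      (R.path (GkV.α ⟨4 * b + 2, by omega⟩)).IsBend (h j) := by
    intro m
    by_cases hm : m < (k + 1) / 2
    · rcases hbd (2 * m) (by omega) with h | h
      · exact ⟨_, fun _ => ⟨Or.inl rfl, h⟩⟩
      · exact ⟨_, fun _ => ⟨Or.inr rfl, h⟩⟩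
    · exact ⟨0, fun h => absurd h hm⟩
  choose γ hγ using G
  choose η hη using H
  classical
  let S1 := (bend_finite (R.path (GkV.α ⟨4 * b + 1, by omega⟩))).toFinset
  let S2 := (bend_finite (R.path (GkV.α ⟨4 * b + 2, by omega⟩))).toFinset
  have c1 : S1.card ≤ k := by
    rw [← Set.ncard_eq_toFinset_card _ (bend_finite _)]; exact hR _
  have c2 : S2.card ≤ k := by
    rw [← Set.ncard_eq_toFinset_card _ (bend_finite _)]; exact hR _
  let T1 := (Finset.range (k + 1)).image f
  let T2 := (Finset.range ((k + 1) / 2)).image (fun m => g (γ m))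
  let T3 := (Finset.range ((k + 1) / 2)).image (fun m => h (η m))
  have d1 : T1.card = k + 1 := by
    rw [Finset.card_image_of_injOn, Finset.card_range]
    intro x hx y hy hxy
    simp at hx hy
    exact finj x y (by omega) (by omega) hxy
  have d2 : T2.card = (k + 1) / 2 := by
    rw [Finset.card_image_of_injOn, Finset.card_range]
    intro x hx y hy hxy
    simp only [Finset.coe_range, Set.mem_Iio] at hx hy
    have e1 := (hγ x hx).1
    have e2 := (hγ y hy).1
    have := ginj _ _ (by omega) (by omega) hxy
    omega
  have d3 : T3.card = (k + 1) / 2 := by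
    rw [Finset.card_image_of_injOn, Finset.card_range]
    intro x hx y hy hxy
    simp only [Finset.coe_range, Set.mem_Iio] at hx hy
    have e1 := (hη x hx).1
    have e2 := (hη y hy).1
    have := hinj _ _ (by omega) (by omega) hxy
    omega
  have m1 : ∀ z ∈ T1, ∃ m, z ∈ (R.path (GkV.u ⟨4 * b + 1, by omega⟩ m)).toSet := by
    intro z hz
    obtain ⟨j, hj, rfl⟩ := Finset.mem_image.1 hz
    exact fm j (by simpa using hj)
  have m2 : ∀ z ∈ T2, ∃ m, z ∈ (R.path (GkV.u ⟨4 * b, by omega⟩ m)).toSet := by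
    intro z hz
    obtain ⟨j, hj, rfl⟩ := Finset.mem_image.1 hz
    have hj := Finset.mem_range.1 hj
    have := (hγ j hj).1
    exact gm _ (by omega)
  have m3 : ∀ z ∈ T3, ∃ m, z ∈ (R.path (GkV.u ⟨4 * b + 2, by omega⟩ m)).toSet := by
    intro z hz
    obtain ⟨j, hj, rfl⟩ := Finset.mem_image.1 hz
    have hj := Finset.mem_range.1 hj
    have := (hη j hj).1
    exact hm _ (by omega)
  have ud : ∀ (i i' : Fin 19) (m m') (z : ℤ × ℤ), i ≠ i' → z ∈ (R.path (GkV.u i m)).toSet →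
      z ∉ (R.path (GkV.u i' m')).toSet := by
    intro i i' m m' z hii hz
    refine disj R ?_ ?_ z hz
    · intro h; cases h; exact hii rfl
    · rw [adj_uu]; exact fun h => hii h.1
  have D12 : Disjoint T1 T2 := by
    rw [Finset.disjoint_left]
    intro z h1 h2
    obtain ⟨m, h1⟩ := m1 z h1
    obtain ⟨m', h2⟩ := m2 z h2
    exact ud _ _ _ _ z (by simp) h1 h2
  have D3 : Disjoint (T1 ∪ T2) T3 := by
    rw [Finset.disjoint_left]
    intro z h1 h3
    obtain ⟨m', h3⟩ := m3 z h3
    rcases Finset.mem_union.1 h1 with h1 | h1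
    · obtain ⟨m, h1⟩ := m1 z h1
      exact ud _ _ _ _ z (by simp) h1 h3
    · obtain ⟨m, h1⟩ := m2 z h1
      exact ud _ _ _ _ z (by simp) h1 h3
  have sub : T1 ∪ T2 ∪ T3 ⊆ S1 ∪ S2 := by
    intro z hz
    rw [Finset.mem_union, Set.Finite.mem_toFinset, Set.Finite.mem_toFinset]
    rcases Finset.mem_union.1 hz with hz | hz
    · rcases Finset.mem_union.1 hz with hz | hz
      · obtain ⟨j, hj, rfl⟩ := Finset.mem_image.1 hz
        exact fb j (by simpa using hj)
      · obtain ⟨j, hj, rfl⟩ := Finset.mem_image.1 hz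
        exact Or.inl (hγ j (Finset.mem_range.1 hj)).2
    · obtain ⟨j, hj, rfl⟩ := Finset.mem_image.1 hz
      exact Or.inr (hη j (Finset.mem_range.1 hj)).2
  have c := Finset.card_le_card sub
  rw [Finset.card_union_of_disjoint D3, Finset.card_union_of_disjoint D12, d1, d2, d3] at c
  have c' := Finset.card_union_le S1 S2
  omega

end GkProof
/-! ### Part D: the construction with `k + 1` bends -/

namespace GkProof

/-- Grid path from a parametrization. -/
def mkP (f : ℕ → ℤ × ℤ) (n : ℕ) (hn : 1 ≤ n) (hs : ∀ t, t < n → GridStep (f t) (f (t + 1)))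
    (hi : ∀ s t, s ≤ n → t ≤ n → f s = f t → s = t) : GridPath where
  pts := (List.range (n + 1)).map f
  two_le_length := by simp; omega
  step := by
    show List.IsChain _ _
    rw [List.isChain_iff_getElem]
    intro i hi
    simp only [List.length_map, List.length_range] at hi
    simp only [List.getElem_map, List.getElem_range]
    exact hs i (by omega)
  nodup := by
    rw [List.nodup_map_iff_inj_on List.nodup_range]
    intro x hx y hy h
    rw [List.mem_range] at hx hy
    exact hi x y (by omega) (by omega) h

section
variable (f : ℕ → ℤ × ℤ) (n : ℕ) (hn : 1 ≤ n) (hs : ∀ t, t < n → GridStep (f t) (f (t + 1)))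
    (hi : ∀ s t, s ≤ n → t ≤ n → f s = f t → s = t)

theorem mkP_mem (p : ℤ × ℤ) : p ∈ (mkP f n hn hs hi).toSet ↔ ∃ t, t ≤ n ∧ f t = p := by
  rw [mem_toSet]
  simp only [mkP, List.mem_map, List.mem_range]
  exact exists_congr fun t => by rw [Nat.lt_succ_iff]

theorem mkP_first : (mkP f n hn hs hi).first = f 0 := by
  simp [GridPath.first, mkP]

theorem mkP_last : (mkP f n hn hs hi).last = f n := by
  simp [GridPath.last, mkP, List.getLast_eq_getElem]

theorem mkP_bend (p : ℤ × ℤ) (h : (mkP f n hn hs hi).IsBend p) :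
    ∃ t, t + 2 ≤ n ∧ p = f (t + 1) ∧ (f t).1 ≠ (f (t + 2)).1 ∧ (f t).2 ≠ (f (t + 2)).2 := by
  obtain ⟨a, c, ⟨l1, l2, h⟩, h1, h2⟩ := h
  have hlen := congrArg List.length h
  simp [mkP] at hlen
  have e : ∀ r : ℕ, (l1 ++ [a, p, c] ++ l2)[r]? = (List.map f (List.range (n + 1)))[r]? := by
    intro r; rw [h]; rfl
  have e0 := e l1.length
  have e1 := e (l1.length + 1)
  have e2 := e (l1.length + 2)
  have g0 : l1.length < n + 1 := by omega
  have g1 : l1.length + 1 < n + 1 := by omega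
  have g2 : l1.length + 2 < n + 1 := by omega
  simp [List.getElem?_append, g0] at e0
  simp [List.getElem?_append, List.getElem?_range, show l1.length < n by omega] at e1
  simp [List.getElem?_append, List.getElem?_range, g2] at e2
  refine ⟨l1.length, by omega, e1, ?_, ?_⟩
  · rw [← e0, ← e2]; exact h1
  · rw [← e0, ← e2]; exact h2

theorem mkP_bends (lo c : ℕ)
    (H : ∀ t, t + 2 ≤ n → (f t).1 ≠ (f (t + 2)).1 → (f t).2 ≠ (f (t + 2)).2 →
      lo ≤ t + 1 ∧ t + 1 < lo + c) : (mkP f n hn hs hi).BendsAtMost c := by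
  unfold GridPath.BendsAtMost
  have : (mkP f n hn hs hi).bendSet ⊆ ((Finset.Ico lo (lo + c)).image f : Finset (ℤ × ℤ)) := by
    intro p hp
    obtain ⟨t, ht, rfl, h1, h2⟩ := mkP_bend f n hn hs hi p hp
    have := H t ht h1 h2
    simp only [Finset.coe_image, Finset.coe_Ico]
    exact ⟨t + 1, ⟨this.1, this.2⟩, rfl⟩
  calc _ ≤ Set.ncard (((Finset.Ico lo (lo + c)).image f : Finset (ℤ × ℤ)) : Set (ℤ × ℤ)) :=
        Set.ncard_le_ncard this (Finset.finite_toSet _)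
    _ = ((Finset.Ico lo (lo + c)).image f).card := Set.ncard_coe_finset _
    _ ≤ (Finset.Ico lo (lo + c)).card := Finset.card_image_le
    _ = c := by simp
end

variable (k : ℕ)

def fa (t : ℕ) : ℤ × ℤ := (-1, 19 - t)

def fb (t : ℕ) : ℤ × ℤ :=
  if t ≤ k / 2 + 31 then (-1 + t, -(k / 2 : ℕ) - 2)
  else ((k / 2 : ℕ) + 30, -(k / 2 : ℕ) - 2 + (t - (k / 2 : ℕ) - 31))

def fα (i : ℕ) (t : ℕ) : ℤ × ℤ :=
  if t ≤ i + 1 then (-1 + t, i)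
  else if t ≤ i + 1 + k then
    (i + ((t - 1 - i : ℕ) / 2 : ℕ), i - ((t - i : ℕ) / 2 : ℕ))
  else if k % 2 = 0 then (i + (k / 2 : ℕ), i + (k / 2 : ℕ) - (t - 1 - i))
  else (i - (k / 2 : ℕ) - 1 + (t - 1 - i), i - (k / 2 : ℕ) - 1)

def nα (i : ℕ) : ℕ :=
  if k % 2 = 0 then 2 * i + 2 * (k / 2) + 3 else 2 * (k / 2) + 32

def fu (i j : ℕ) (t : ℕ) : ℤ × ℤ := (i + ((j + t) / 2 : ℕ), i + 1 - ((j + t + 1) / 2 : ℕ))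

def pa : GridPath := mkP fa (21 + k / 2) (by omega)
  (by intro t ht; simp only [GridStep, fa]; omega)
  (by intro s t hs ht h; simp only [fa, Prod.mk.injEq] at h; omega)

def pb : GridPath := mkP (fb k) (2 * (k / 2) + 52) (by omega)
  (by intro t ht; simp only [GridStep, fb]; split_ifs <;> simp only <;> omega)
  (by
    intro s t hs ht h
    simp only [fb] at h
    split_ifs at h <;> simp only [Prod.mk.injEq] at h <;> omega)

theorem fα_diff (i t : ℕ) : (fα k i t).1 - (fα k i t).2 = t - 1 - i := by
  unfold fα
  split_ifs <;> simp only <;> omega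

def pα (i : ℕ) (hi : i < 20) : GridPath := mkP (fα k i) (nα k i)
  (by unfold nα; split_ifs <;> omega)
  (by
    intro t ht
    unfold nα at ht
    simp only [GridStep, fα]
    split_ifs <;> simp only <;> omega)
  (by
    intro s t hs ht h
    have h1 := fα_diff k i s
    have h2 := fα_diff k i t
    rw [h] at h1
    omega)

def pu (i j : ℕ) : GridPath := mkP (fu i j) 1 le_rfl
  (by intro t ht; simp only [GridStep, fu]; omega)
  (by intro s t hs ht h; simp only [fu, Prod.mk.injEq] at h; omega)

def pth : GkV k → GridPath
  | .a => pa k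
  | .b => pb k
  | .α i => pα k i i.2
  | .u i j => pu i j

/-- Explicit description of the point sets. -/
def pS : GkV k → ℤ → ℤ → Prop
  | .a => fun x y => x = -1 ∧ -(k / 2 : ℕ) - 2 ≤ y ∧ y ≤ 19
  | .b => fun x y => (y = -(k / 2 : ℕ) - 2 ∧ -1 ≤ x ∧ x ≤ (k / 2 : ℕ) + 30) ∨
      (x = (k / 2 : ℕ) + 30 ∧ -(k / 2 : ℕ) - 2 ≤ y ∧ y ≤ 19)
  | .α i => fun x y => (y = (i : ℕ) ∧ -1 ≤ x ∧ x ≤ (i : ℕ)) ∨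
      ((x + y = 2 * (i : ℕ) ∨ x + y = 2 * (i : ℕ) - 1) ∧ 0 ≤ x - y ∧ x - y ≤ k) ∨
      (k % 2 = 0 ∧ x = (k / 2 : ℕ) + (i : ℕ) ∧ -(k / 2 : ℕ) - 2 ≤ y ∧ y ≤ (i : ℕ) - (k / 2 : ℕ)) ∨
      (k % 2 = 1 ∧ y = (i : ℕ) - (k / 2 : ℕ) - 1 ∧ (k / 2 : ℕ) + (i : ℕ) ≤ x ∧
        x ≤ (k / 2 : ℕ) + 30)
  | .u i j => fun x y => (2 * (i : ℕ) ≤ x + y ∧ x + y ≤ 2 * (i : ℕ) + 1) ∧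
      (x - y = (j : ℕ) - 1 ∨ x - y = (j : ℕ))

def pE : GkV k → ℤ → ℤ → Prop
  | .a => fun x y => x = -1 ∧ (y = 19 ∨ y = -(k / 2 : ℕ) - 2)
  | .b => fun x y => (x = -1 ∧ y = -(k / 2 : ℕ) - 2)
  | .α i => fun x y => (x = -1 ∧ y = (i : ℕ)) ∨
      (k % 2 = 0 ∧ x = (k / 2 : ℕ) + (i : ℕ) ∧ y = -(k / 2 : ℕ) - 2) ∨
      (k % 2 = 1 ∧ y = (i : ℕ) - (k / 2 : ℕ) - 1 ∧ x = (k / 2 : ℕ) + 30)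
  | .u i j => fun x y => (2 * (i : ℕ) ≤ x + y ∧ x + y ≤ 2 * (i : ℕ) + 1) ∧
      (x - y = (j : ℕ) - 1 ∨ x - y = (j : ℕ))

theorem mem_pth (v : GkV k) (x y : ℤ) : (x, y) ∈ (pth k v).toSet ↔ pS k v x y := by
  cases v with
  | a =>
    simp only [pth, pa, mkP_mem, pS, fa, Prod.mk.injEq]
    constructor
    · rintro ⟨t, ht, h1, h2⟩; omega
    · intro h; exact ⟨(19 - y).toNat, by omega, by omega, by omega⟩
  | b =>
    simp only [pth, pb, mkP_mem, pS, fb]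
    constructor
    · rintro ⟨t, ht, h⟩
      split_ifs at h <;> simp only [Prod.mk.injEq] at h <;> omega
    · rintro (h | h)
      · refine ⟨(x + 1).toNat, by omega, ?_⟩
        split_ifs <;> simp only [Prod.mk.injEq] <;> omega
      · refine ⟨(y + (k / 2 : ℕ) + 2 + (k / 2 : ℕ) + 31).toNat, by omega, ?_⟩
        split_ifs <;> simp only [Prod.mk.injEq] <;> omega
  | α i =>
    have hi := i.2
    simp only [pth, pα, mkP_mem, pS, fα]
    constructor
    · rintro ⟨t, ht, h⟩
      unfold nα at ht
      split_ifs at h ht <;> simp only [Prod.mk.injEq] at h <;> omega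
    · intro h
      refine ⟨(x - y + 1 + (i : ℕ)).toNat, ?_, ?_⟩
      · unfold nα
        split_ifs <;> omega
      · split_ifs <;> simp only [Prod.mk.injEq] <;> omega
  | u i j =>
    simp only [pth, pu, mkP_mem, pS, fu, Prod.mk.injEq]
    constructor
    · rintro ⟨t, ht, h1, h2⟩; omega
    · intro h; exact ⟨(x - y + 1 - (j : ℕ)).toNat, by omega, by omega, by omega⟩

theorem end_pth (v : GkV k) (x y : ℤ) (h : pE k v x y) : (pth k v).IsEndpoint (x, y) := by
  unfold GridPath.IsEndpoint
  cases v with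
  | a =>
    simp only [pth, pa, mkP_first, mkP_last, pE, fa, Prod.mk.injEq] at *
    omega
  | b =>
    left
    simp only [pth, pb, mkP_first, pE, fb] at *
    split_ifs <;> simp only [Prod.mk.injEq] <;> omega
  | α i =>
    have hi := i.2
    simp only [pth, pα, mkP_first, mkP_last, pE] at *
    rcases h with h | h
    · left
      simp only [fα]
      split_ifs <;> simp only [Prod.mk.injEq] <;> omega
    · right
      simp only [fα, nα]
      split_ifs <;> simp only [Prod.mk.injEq] <;> omega
  | u i j =>
    simp only [pth, pu, mkP_first, mkP_last, pE, fu, Prod.mk.injEq] at *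
    omega

/-- Everything needed about an unordered pair of vertices. -/
def Good (u v : GkV k) : Prop :=
  ((Gk k).Adj u v → ∃ x y, pS k u x y ∧ pS k v x y) ∧
  (∀ x y, pS k u x y → pS k v x y → (Gk k).Adj u v ∧ (pE k u x y ∨ pE k v x y)) ∧
  (∀ x y x' y', pS k u x y → pS k v x y → pS k u x' y' → pS k v x' y' → x = x' ∧ y = y')

theorem Good.symm {u v : GkV k} (h : Good k u v) : Good k v u := by
  obtain ⟨h1, h2, h3⟩ := h
  refine ⟨fun h => ?_, fun x y a b => ?_, fun x y x' y' a b c d => h3 x y x' y' b a d c⟩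
  · obtain ⟨x, y, a, b⟩ := h1 h.symm
    exact ⟨x, y, b, a⟩
  · obtain ⟨a, b⟩ := h2 x y b a
    exact ⟨a.symm, b.symm⟩

theorem good_ab : Good k .a .b := by
  refine ⟨fun _ => ⟨-1, -(k / 2 : ℕ) - 2, ?_⟩, fun x y h1 h2 => ⟨adj_ab, ?_⟩,
    fun x y x' y' h1 h2 h3 h4 => ?_⟩ <;> simp only [pS, pE, true_and, and_true, true_or, or_true, and_self] at * <;> omega

theorem good_aα (i : Fin 20) : Good k .a (.α i) := by
  have := i.2
  refine ⟨fun _ => ⟨-1, (i : ℕ), ?_⟩, fun x y h1 h2 => ⟨adj_aα i, ?_⟩,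
    fun x y x' y' h1 h2 h3 h4 => ?_⟩ <;> simp only [pS, pE, true_and, and_true, true_or, or_true, and_self] at * <;> omega

theorem good_bα (i : Fin 20) : Good k .b (.α i) := by
  have := i.2
  refine ⟨fun _ => ?_, fun x y h1 h2 => ⟨adj_bα i, ?_⟩,
    fun x y x' y' h1 h2 h3 h4 => ?_⟩
  · by_cases hk : k % 2 = 0
    · refine ⟨(k / 2 : ℕ) + (i : ℕ), -(k / 2 : ℕ) - 2, ?_⟩
      simp only [pS, true_and, and_true, true_or, or_true, and_self]; omega
    · refine ⟨(k / 2 : ℕ) + 30, (i : ℕ) - (k / 2 : ℕ) - 1, ?_⟩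
      simp only [pS, true_and, and_true, true_or, or_true, and_self]; omega
  all_goals simp only [pS, pE, true_and, and_true, true_or, or_true, and_self] at *; omega

theorem good_au (i : Fin 19) (j : Fin (k + 2)) : Good k .a (.u i j) := by
  have := i.2
  have := j.2
  have key : ∀ x y, pS k .a x y → pS k (.u i j) x y → False := by
    intro x y h1 h2; simp only [pS] at *; omega
  exact ⟨fun h => absurd h (nadj_au i j), fun x y h1 h2 => (key x y h1 h2).elim,
    fun x y _ _ h1 h2 => (key x y h1 h2).elim⟩

theorem good_bu (i : Fin 19) (j : Fin (k + 2)) : Good k .b (.u i j) := by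
  have := i.2
  have := j.2
  have key : ∀ x y, pS k .b x y → pS k (.u i j) x y → False := by
    intro x y h1 h2; simp only [pS] at *; omega
  exact ⟨fun h => absurd h (nadj_bu i j), fun x y h1 h2 => (key x y h1 h2).elim,
    fun x y _ _ h1 h2 => (key x y h1 h2).elim⟩

theorem good_αα (i j : Fin 20) (h : i ≠ j) : Good k (.α i) (.α j) := by
  have := i.2
  have := j.2
  have hij : (i : ℕ) ≠ j := fun h' => h (Fin.ext h')
  have key : ∀ x y, pS k (.α i) x y → pS k (.α j) x y → False := by
    intro x y h1 h2; simp only [pS] at *; omega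
  exact ⟨fun h => absurd h (nadj_αα i j), fun x y h1 h2 => (key x y h1 h2).elim,
    fun x y _ _ h1 h2 => (key x y h1 h2).elim⟩

theorem good_αu (l : Fin 20) (i : Fin 19) (j : Fin (k + 2)) : Good k (.α l) (.u i j) := by
  have := i.2
  have := j.2
  have := l.2
  unfold Good
  rw [adj_αu]
  refine ⟨fun h => ?_, fun x y h1 h2 => ⟨?_, ?_⟩,
    fun x y x' y' h1 h2 h3 h4 => ?_⟩
  · -- the endpoint `v_s` with `s ∈ {j, j + 1}`, `s + l - i` odd, lies on `α_l`
    by_cases hs : ((j : ℕ) + l + i) % 2 = 1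
    · refine ⟨(i : ℕ) + ((j : ℕ) / 2 : ℕ), (i : ℕ) + 1 - (((j : ℕ) + 1) / 2 : ℕ), ?_⟩
      simp only [pS, true_and, and_true, true_or, or_true, and_self]; omega
    · refine ⟨(i : ℕ) + (((j : ℕ) + 1) / 2 : ℕ), (i : ℕ) + 1 - (((j : ℕ) + 2) / 2 : ℕ), ?_⟩
      simp only [pS, true_and, and_true, true_or, or_true, and_self]; omega
  all_goals simp only [pS, pE, true_and, and_true, true_or, or_true, and_self] at *; omega

theorem good_uu (i i' : Fin 19) (j j' : Fin (k + 2)) (h : GkV.u i j ≠ GkV.u i' j') :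
    Good k (.u i j) (.u i' j') := by
  have := i.2
  have := j.2
  have := i'.2
  have := j'.2
  have hne : ¬ ((i : ℕ) = i' ∧ (j : ℕ) = j') := by
    rintro ⟨h1, h2⟩
    exact h (by rw [Fin.ext h1, Fin.ext h2])
  unfold Good
  rw [adj_uu, Fin.ext_iff]
  refine ⟨fun h => ?_, fun x y h1 h2 => ⟨?_, Or.inl h1⟩,
    fun x y x' y' h1 h2 h3 h4 => ?_⟩
  · obtain ⟨e, h | h⟩ := h
    · refine ⟨(i : ℕ) + ((j' : ℕ) / 2 : ℕ), (i : ℕ) + 1 - (((j' : ℕ) + 1) / 2 : ℕ), ?_⟩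
      simp only [pS, true_and, and_true, true_or, or_true, and_self]; omega
    · refine ⟨(i : ℕ) + ((j : ℕ) / 2 : ℕ), (i : ℕ) + 1 - (((j : ℕ) + 1) / 2 : ℕ), ?_⟩
      simp only [pS, true_and, and_true, true_or, or_true, and_self]; omega
  all_goals simp only [pS] at *; omega

theorem good (u v : GkV k) (h : u ≠ v) : Good k u v := by
  rcases u with _ | _ | i | ⟨i, j⟩ <;> rcases v with _ | _ | i' | ⟨i', j'⟩
  · exact absurd rfl h
  · exact good_ab k
  · exact good_aα k _
  · exact good_au k _ _
  · exact (good_ab k).symm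
  · exact absurd rfl h
  · exact good_bα k _
  · exact good_bu k _ _
  · exact (good_aα k _).symm
  · exact (good_bα k _).symm
  · exact good_αα k _ _ (fun e => h (by rw [e]))
  · exact good_αu k _ _ _
  · exact (good_au k _ _).symm
  · exact (good_bu k _ _).symm
  · exact (good_αu k _ _ _).symm
  · exact good_uu k _ _ _ _ h

theorem consec_props {P : GridPath} {p q : ℤ × ℤ} (h : ConsecIn P.pts p q) :
    p ∈ P.toSet ∧ q ∈ P.toSet ∧ p ≠ q := by
  have hn := P.nodup
  rcases h with h | h
  · refine ⟨h.subset (by simp), h.subset (by simp), ?_⟩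
    have := hn.sublist h.sublist
    simpa using this
  · refine ⟨h.subset (by simp), h.subset (by simp), ?_⟩
    have := hn.sublist h.sublist
    simp at this
    exact fun e => this e.symm

def rep : CPGRep (Gk k) where
  path := pth k
  interiorly_disjoint := by
    rintro u v h ⟨x, y⟩ h1 h2
    rw [mem_pth] at h1 h2
    rcases ((good k u v h).2.1 x y h1 h2).2 with e | e
    · exact Or.inl (end_pth k _ _ _ e)
    · exact Or.inr (end_pth k _ _ _ e)
  no_shared_segment := by
    rintro u v h ⟨x, y⟩ ⟨x', y'⟩ h1 h2
    obtain ⟨a1, a2, a3⟩ := consec_props h1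
    obtain ⟨b1, b2, b3⟩ := consec_props h2
    rw [mem_pth] at a1 a2 b1 b2
    obtain ⟨rfl, rfl⟩ := (good k u v h).2.2 x y x' y' a1 b1 a2 b2
    exact a3 rfl
  adj_iff := by
    intro u v h
    constructor
    · intro ha
      obtain ⟨x, y, h1, h2⟩ := (good k u v h).1 ha
      exact ⟨(x, y), (mem_pth k _ _ _).2 h1, (mem_pth k _ _ _).2 h2⟩
    · rintro ⟨⟨x, y⟩, h1, h2⟩
      rw [mem_pth] at h1 h2
      exact ((good k u v h).2.1 x y h1 h2).1

theorem is_Bk : IsBkCPG (Gk k) (k + 1) := by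
  refine ⟨rep k, fun v => ?_⟩
  show (pth k v).BendsAtMost (k + 1)
  cases v with
  | a =>
    unfold pth pa
    refine mkP_bends _ _ _ _ _ 0 _ ?_
    intro t ht h1 h2
    simp [fa] at h1
  | b =>
    unfold pth pb
    refine mkP_bends _ _ _ _ _ (k / 2 + 31) _ ?_
    intro t ht h1 h2
    unfold fb at h1 h2
    split_ifs at h1 h2 <;> simp only at h1 h2 <;> omega
  | α i =>
    unfold pth pα
    refine mkP_bends _ _ _ _ _ (i + 1) _ ?_
    intro t ht h1 h2
    unfold nα at ht
    unfold fα at h1 h2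
    split_ifs at h1 h2 ht <;> simp only at h1 h2 <;> omega
  | u i j =>
    unfold pth pu
    refine mkP_bends _ _ _ _ _ 0 _ ?_
    intro t ht h1 h2
    omega

end GkProof

theorem Gk_is_B_succ_k_CPG_not_Bk_CPG (k : ℕ) :
    IsBkCPG (Gk k) (k + 1) ∧ ¬ IsBkCPG (Gk k) k := by
  exact ⟨GkProof.is_Bk k, GkProof.not_Bk k⟩
end

section
/- Let R be a CPG representation of G_k, let 1 ≤ i ≤ 19 be such that the paths P_{α_i} and P_{α_{i+1}} are pure, and let 1 ≤ j ≤ k+1. If a grid point x belongs to both P_{u^i_j} and P_{u^i_{j+1}}, then x is an endpoint of both P_{u^i_j} and P_{u^i_{j+1}}, and x is a bend point of P_{α_i} or of P_{α_{i+1}}. -/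
/-! ## Helper lemmas -/

/-- Grid adjacency inside a set of grid points. -/
def StepIn (A : Set (ℤ × ℤ)) (p q : ℤ × ℤ) : Prop := GridStep p q ∧ p ∈ A ∧ q ∈ A

/-- Connectedness inside a set of grid points. -/
def ConnIn (A : Set (ℤ × ℤ)) (p q : ℤ × ℤ) : Prop := Relation.ReflTransGen (StepIn A) p q

theorem GridStep.symm {p q : ℤ × ℤ} (h : GridStep p q) : GridStep q p := by
  unfold GridStep at *; omega

theorem ConnIn.symm {A : Set (ℤ × ℤ)} {p q : ℤ × ℤ} (h : ConnIn A p q) : ConnIn A q p := by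
  have hs : Std.Symm (StepIn A) := ⟨fun a b hab => ⟨hab.1.symm, hab.2.2, hab.2.1⟩⟩
  exact Std.Symm.symm (r := Relation.ReflTransGen (StepIn A)) p q h

theorem ConnIn.mono {A B : Set (ℤ × ℤ)} (hAB : A ⊆ B) {p q : ℤ × ℤ} (h : ConnIn A p q) :
    ConnIn B p q :=
  Relation.ReflTransGen.mono
    (show StepIn A ≤ StepIn B from fun _ _ hab => ⟨hab.1, hAB hab.2.1, hAB hab.2.2⟩) p q h

theorem ConnIn.trans {A : Set (ℤ × ℤ)} {p q r : ℤ × ℤ} (h : ConnIn A p q) (h' : ConnIn A q r) :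
    ConnIn A p r := Relation.ReflTransGen.trans h h'

theorem connIn_head (l : List (ℤ × ℤ)) : ∀ (p : ℤ × ℤ), (p :: l).IsChain GridStep →
    ∀ q ∈ p :: l, ConnIn {z | z ∈ p :: l} p q := by
  induction l with
  | nil =>
    intro p _ q hq
    simp at hq
    subst hq
    exact Relation.ReflTransGen.refl
  | cons r l ih =>
    intro p hc q hq
    rw [List.isChain_cons_cons] at hc
    rcases List.mem_cons.1 hq with rfl | hq
    · exact Relation.ReflTransGen.refl
    · have h1 := (ih r hc.2 q hq).mono (B := {z | z ∈ p :: r :: l})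
        (fun z hz => List.mem_cons_of_mem _ hz)
      exact Relation.ReflTransGen.head ⟨hc.1, by simp, by simp⟩ h1

theorem connIn_of_chain {l : List (ℤ × ℤ)} (hc : l.IsChain GridStep) {A : Set (ℤ × ℤ)}
    (hA : ∀ z ∈ l, z ∈ A) {p q : ℤ × ℤ} (hp : p ∈ l) (hq : q ∈ l) : ConnIn A p q := by
  cases l with
  | nil => simp at hp
  | cons r l =>
    exact (((connIn_head l r hc p hp).symm).trans (connIn_head l r hc q hq)).mono hA

/-! ### A discrete Jordan lemma -/

/-- Signed crossing of the edge `pq` with the horizontal ray to the right of `w + (0,1/2)`. -/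
def crossing (w p q : ℤ × ℤ) : ℤ :=
  if p.1 = q.1 ∧ w.1 < p.1 then
    (if p.2 = w.2 ∧ q.2 = w.2 + 1 then 1 else if p.2 = w.2 + 1 ∧ q.2 = w.2 then -1 else 0)
  else 0

/-- Indicator of the half-line strictly to the right of `w + (0,1)`. -/
def rayInd (w p : ℤ × ℤ) : ℤ := if p.2 = w.2 + 1 ∧ w.1 < p.1 then 1 else 0

/-- `F` behaves as the crossing number of a walk from `p` to `q` inside `A`. -/
def GoodFor (A : Set (ℤ × ℤ)) (p q : ℤ × ℤ) (F : ℤ × ℤ → ℤ) : Prop :=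
  (∀ w : ℤ × ℤ, (w.1 + 1, w.2) ∉ A → F w = F (w.1 + 1, w.2)) ∧
  (∀ w : ℤ × ℤ, (w.1, w.2 + 1) ∉ A → F w - F (w.1, w.2 + 1) = rayInd w q - rayInd w p)

theorem goodFor_step {A : Set (ℤ × ℤ)} {p q : ℤ × ℤ} (h : StepIn A p q) :
    GoodFor A p q (fun w => crossing w p q) := by
  obtain ⟨hs, hp, hq⟩ := h
  obtain ⟨p1, p2⟩ := p
  obtain ⟨q1, q2⟩ := q
  unfold GridStep at hs
  constructor
  · rintro ⟨w1, w2⟩ hw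
    have h1 : ¬ (p1 = w1 + 1 ∧ p2 = w2) := by rintro ⟨rfl, rfl⟩; exact hw hp
    have h2 : ¬ (q1 = w1 + 1 ∧ q2 = w2) := by rintro ⟨rfl, rfl⟩; exact hw hq
    simp only [crossing] at *
    split_ifs <;> omega
  · rintro ⟨w1, w2⟩ hw
    have h1 : ¬ (p1 = w1 ∧ p2 = w2 + 1) := by rintro ⟨rfl, rfl⟩; exact hw hp
    have h2 : ¬ (q1 = w1 ∧ q2 = w2 + 1) := by rintro ⟨rfl, rfl⟩; exact hw hq
    simp only [crossing, rayInd] at *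
    split_ifs <;> omega

theorem GoodFor.add {A : Set (ℤ × ℤ)} {p q r : ℤ × ℤ} {F G : ℤ × ℤ → ℤ}
    (hF : GoodFor A p q F) (hG : GoodFor A q r G) : GoodFor A p r (fun w => F w + G w) := by
  constructor
  · intro w hw
    have := hF.1 w hw
    have := hG.1 w hw
    simp only
    omega
  · intro w hw
    have := hF.2 w hw
    have := hG.2 w hw
    simp only
    omega

theorem GoodFor.mono {A B : Set (ℤ × ℤ)} (hAB : A ⊆ B) {p q : ℤ × ℤ} {F : ℤ × ℤ → ℤ}
    (hF : GoodFor A p q F) : GoodFor B p q F :=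
  ⟨fun w hw => hF.1 w fun h => hw (hAB h), fun w hw => hF.2 w fun h => hw (hAB h)⟩

theorem exists_goodFor {A : Set (ℤ × ℤ)} {p q : ℤ × ℤ} (h : ConnIn A p q) :
    ∃ F, GoodFor A p q F := by
  induction h with
  | refl => exact ⟨fun _ => 0, fun _ _ => rfl, fun _ _ => by simp⟩
  | tail _ hs ih =>
    obtain ⟨F, hF⟩ := ih
    exact ⟨_, hF.add (goodFor_step hs)⟩

theorem goodFor_closed_const {A B : Set (ℤ × ℤ)} {p : ℤ × ℤ} {F : ℤ × ℤ → ℤ}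
    (hF : GoodFor A p p F) (hAB : ∀ z ∈ B, z ∉ A) {y z : ℤ × ℤ} (h : ConnIn B y z) :
    F y = F z := by
  induction h with
  | refl => rfl
  | @tail b c _ hs ih =>
    rw [ih]
    obtain ⟨hs, hb, hc⟩ := hs
    have hb := hAB b hb
    have hc := hAB c hc
    obtain ⟨b1, b2⟩ := b
    obtain ⟨c1, c2⟩ := c
    unfold GridStep at hs
    simp only at hs
    have hcase : (c1 = b1 + 1 ∧ c2 = b2) ∨ (b1 = c1 + 1 ∧ b2 = c2) ∨
        (c1 = b1 ∧ c2 = b2 + 1) ∨ (b1 = c1 ∧ b2 = c2 + 1) := by omega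
    rcases hcase with ⟨rfl, rfl⟩ | ⟨rfl, rfl⟩ | ⟨rfl, rfl⟩ | ⟨rfl, rfl⟩
    · exact hF.1 (_, _) hc
    · exact (hF.1 (_, _) hb).symm
    · have := hF.2 (_, _) hc
      simp only at this
      omega
    · have := hF.2 (_, _) hb
      simp only at this
      omega

/-- Discrete Jordan lemma: two disjoint connected sets of grid points cannot cross at `x`. -/
theorem no_crossing {C B : Set (ℤ × ℤ)} {x1 x2 : ℤ} (hxC : (x1, x2) ∉ C) (hxB : (x1, x2) ∉ B)
    (hCB : ∀ z ∈ B, z ∉ C)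
    (hl : (x1, x2 - 1) ∈ C) (hr : (x1, x2 + 1) ∈ C) (hC : ConnIn C (x1, x2 - 1) (x1, x2 + 1))
    (hy : (x1 - 1, x2) ∈ B) (hz : (x1 + 1, x2) ∈ B)
    (hB : ConnIn B (x1 - 1, x2) (x1 + 1, x2)) : False := by
  obtain ⟨F, hF⟩ := exists_goodFor hC.symm
  have e1 : F (x1 - 1, x2) = F (x1, x2) := by
    have := hF.1 (x1 - 1, x2) (by simpa using hxC)
    simpa using this
  have e2 : F (x1, x2) = F (x1 + 1, x2) := hF.1 (x1, x2) (hCB _ hz)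
  have s1 : StepIn (insert (x1, x2) C) (x1, x2 - 1) (x1, x2) :=
    ⟨by unfold GridStep; simp, Or.inr hl, Or.inl rfl⟩
  have s2 : StepIn (insert (x1, x2) C) (x1, x2) (x1, x2 + 1) :=
    ⟨by unfold GridStep; simp, Or.inl rfl, Or.inr hr⟩
  have hG := ((hF.mono (Set.subset_insert (x1, x2) C)).add (goodFor_step s1)).add (goodFor_step s2)
  have hdis : ∀ z ∈ B, z ∉ insert (x1, x2) C := by
    intro z hz hz'
    rcases hz' with rfl | hz'
    · exact hxB hz
    · exact hCB z hz hz'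
  have := goodFor_closed_const hG hdis hB
  simp [crossing, e1, e2] at this
  split_ifs at this <;> omega

theorem no_crossing_gen {C B : Set (ℤ × ℤ)} {x l r y z : ℤ × ℤ} (hxC : x ∉ C) (hxB : x ∉ B)
    (hCB : ∀ z ∈ B, z ∉ C)
    (hl : l ∈ C) (hr : r ∈ C) (hC : ConnIn C l r) (hy : y ∈ B) (hz : z ∈ B) (hB : ConnIn B y z)
    (sl : GridStep x l) (sr : GridStep x r) (sy : GridStep x y) (sz : GridStep x z)
    (hlr : l ≠ r) (hyz : y ≠ z) : l.1 ≠ r.1 ∧ l.2 ≠ r.2 := by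
  have hly : l ≠ y := by rintro rfl; exact hCB _ hy hl
  have hlz : l ≠ z := by rintro rfl; exact hCB _ hz hl
  have hry : r ≠ y := by rintro rfl; exact hCB _ hy hr
  have hrz : r ≠ z := by rintro rfl; exact hCB _ hz hr
  have hBC : ∀ z ∈ C, z ∉ B := fun z h h' => hCB z h' h
  obtain ⟨x1, x2⟩ := x
  have key : ∀ w : ℤ × ℤ, GridStep (x1, x2) w →
      w = (x1 - 1, x2) ∨ w = (x1 + 1, x2) ∨ w = (x1, x2 - 1) ∨ w = (x1, x2 + 1) := by
    rintro ⟨w1, w2⟩ h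
    unfold GridStep at h
    simp only [Prod.mk.injEq] at *
    omega
  by_contra hcon
  rcases key l sl with rfl | rfl | rfl | rfl <;> rcases key r sr with rfl | rfl | rfl | rfl <;>
    first
    | exact hlr rfl
    | (exfalso; apply hcon; constructor <;> simp <;> omega)
    | (rcases key y sy with rfl | rfl | rfl | rfl <;> rcases key z sz with rfl | rfl | rfl | rfl <;>
        first
        | exact hyz rfl
        | exact hly rfl
        | exact hlz rfl
        | exact hry rfl
        | exact hrz rfl
        | exact no_crossing hxC hxB hCB hl hr hC hy hz hB
        | exact no_crossing hxC hxB hCB hl hr hC hz hy hB.symm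
        | exact no_crossing hxC hxB hCB hr hl hC.symm hy hz hB
        | exact no_crossing hxC hxB hCB hr hl hC.symm hz hy hB.symm
        | exact no_crossing hxB hxC hBC hy hz hB hl hr hC
        | exact no_crossing hxB hxC hBC hy hz hB hr hl hC.symm
        | exact no_crossing hxB hxC hBC hz hy hB.symm hl hr hC
        | exact no_crossing hxB hxC hBC hz hy hB.symm hr hl hC.symm)

/-! ### Structure of grid paths -/

theorem GridPath.first_mem (P : GridPath) : P.first ∈ P.toSet := List.head_mem P.ne_nil

theorem GridPath.last_mem (P : GridPath) : P.last ∈ P.toSet := List.getLast_mem P.ne_nil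

theorem GridPath.conn (P : GridPath) {p q : ℤ × ℤ} (hp : p ∈ P.toSet) (hq : q ∈ P.toSet) :
    ConnIn P.toSet p q := connIn_of_chain P.step (fun _ h => h) hp hq

/-- Neighbours of an interior point. -/
theorem GridPath.interior_split (P : GridPath) {x : ℤ × ℤ} (hx : x ∈ P.toSet)
    (hne : ¬ P.IsEndpoint x) :
    ∃ l r, [l, x, r] <:+: P.pts ∧ GridStep x l ∧ GridStep x r ∧ l ≠ r ∧
      l ∈ P.toSet \ {x} ∧ r ∈ P.toSet \ {x} ∧
      ConnIn (P.toSet \ {x}) P.first l ∧ ConnIn (P.toSet \ {x}) r P.last := by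
  obtain ⟨pts, h2, hc, hn⟩ := P
  change pts.IsChain GridStep at hc
  unfold IsEndpoint first last at *
  simp only [toSet, Set.mem_ofPred_eq] at *
  obtain ⟨s, t, rfl⟩ := List.append_of_mem hx
  rcases List.eq_nil_or_concat s with rfl | ⟨s, l, rfl⟩
  · simp at hne
  rcases t with _ | ⟨r, t⟩
  · simp at hne
  have hc' : List.IsChain GridStep (s ++ [l] ++ x :: r :: t) := by simpa using hc
  have c1 : (s ++ [l]).IsChain GridStep := hc'.left_of_append
  have c2 : (x :: r :: t).IsChain GridStep := hc'.right_of_append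
  have c3 : (r :: t).IsChain GridStep := (List.isChain_cons_cons.1 c2).2
  have c4 : ([l, x]).IsChain GridStep := hc'.infix ⟨s, r :: t, by simp⟩
  simp [List.nodup_append] at hn
  refine ⟨l, r, ⟨s, t, by simp⟩, ?_, ?_, ?_, ?_, ?_, ?_, ?_⟩
  · exact GridStep.symm (by simpa using c4)
  · exact (List.isChain_cons_cons.1 c2).1
  · grind
  · simp; grind
  · simp; grind
  · refine connIn_of_chain c1 ?_ ?_ ?_
    · intro z hz; simp at hz ⊢; grind
    · cases s <;> simp
    · simp
  · refine connIn_of_chain c3 ?_ ?_ ?_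
    · intro z hz; simp at hz ⊢; grind
    · simp
    · simp

/-- Neighbour of an endpoint. -/
theorem GridPath.endpoint_split (P : GridPath) {x : ℤ × ℤ} (hx : P.IsEndpoint x) :
    ∃ y, y ∈ P.toSet \ {x} ∧ GridStep x y ∧ ConsecIn P.pts x y ∧
      ∀ z ∈ P.toSet, z ≠ x → ConnIn (P.toSet \ {x}) y z := by
  obtain ⟨pts, h2, hc, hn⟩ := P
  change pts.IsChain GridStep at hc
  unfold IsEndpoint first last at *
  simp only [toSet, Set.mem_ofPred_eq] at *
  rcases hx with rfl | rfl
  · rcases pts with _ | ⟨x, _ | ⟨y, t⟩⟩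
    · simp at h2
    · simp at h2
    · have hc' : (x :: y :: t).IsChain GridStep := hc
      rw [List.isChain_cons_cons] at hc'
      simp at hn
      refine ⟨y, ?_, hc'.1, Or.inl ⟨[], t, by simp⟩, ?_⟩
      · simp; grind
      · intro z hz hzx
        refine connIn_of_chain hc'.2 ?_ (by simp) ?_
        · intro w hw; simp at hw ⊢; grind
        · simp at hz hzx ⊢; grind
  · rcases List.eq_nil_or_concat pts with rfl | ⟨s, x, rfl⟩
    · simp at h2
    rcases List.eq_nil_or_concat s with rfl | ⟨s, y, rfl⟩
    · simp at h2
    have hc' : List.IsChain GridStep (s ++ [y] ++ [x]) := by simpa using hc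
    have c1 : (s ++ [y]).IsChain GridStep := hc'.left_of_append
    have c4 : ([y, x]).IsChain GridStep := hc'.infix ⟨s, [], by simp⟩
    simp [List.nodup_append] at hn
    refine ⟨y, ?_, ?_, Or.inr ⟨s, [], by simp⟩, ?_⟩
    · simp; grind
    · simp; exact GridStep.symm (by simpa using c4)
    · intro z hz hzx
      refine connIn_of_chain c1 ?_ (by simp) ?_
      · intro w hw; simp at hw ⊢; grind
      · simp at hz hzx ⊢; grind

/-- The interior of a grid path is connected. -/
theorem GridPath.interior_conn (P : GridPath) {p q : ℤ × ℤ} (hp : P.IsInterior p)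
    (hq : P.IsInterior q) : ConnIn {z | P.IsInterior z} p q := by
  obtain ⟨pts, h2, hc, hn⟩ := P
  change pts.IsChain GridStep at hc
  unfold IsInterior IsEndpoint first last at *
  simp only [toSet, Set.mem_ofPred_eq] at *
  rcases pts with _ | ⟨f, pts⟩
  · simp at h2
  rcases List.eq_nil_or_concat pts with rfl | ⟨s, g, rfl⟩
  · simp at h2
  have hc' : List.IsChain GridStep ([f] ++ s ++ [g]) := by simpa using hc
  have c1 : s.IsChain GridStep := hc'.left_of_append.right_of_append
  simp [List.nodup_append] at hn
  refine connIn_of_chain c1 ?_ ?_ ?_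
  · intro w hw; simp; grind
  · simp at hp; grind
  · simp at hq; grind

/-! ### The combinatorial core -/

/-- Interior disjointness (points only). -/
def IntDisj (P Q : GridPath) : Prop :=
  ∀ p, p ∈ P.toSet → p ∈ Q.toSet → P.IsEndpoint p ∨ Q.IsEndpoint p

/-- `P` behaves as a pure secondary path with respect to `A` and `B`. -/
structure PureFor (A B P : GridPath) : Prop where
  dA : IntDisj A P
  dB : IntDisj B P
  mA : ∃ p, p ∈ A.toSet ∧ p ∈ P.toSet
  mB : ∃ p, p ∈ B.toSet ∧ p ∈ P.toSet
  pA : ∀ p, A.IsEndpoint p → p ∉ P.toSet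
  pB : ∀ p, B.IsEndpoint p → p ∉ P.toSet

/-- `U` behaves as a sewing path between `P` and `Q`. -/
structure SewFor (A B P Q U : GridPath) : Prop where
  dP : IntDisj P U
  dQ : IntDisj Q U
  mP : ∃ p, p ∈ P.toSet ∧ p ∈ U.toSet
  mQ : ∃ p, p ∈ Q.toSet ∧ p ∈ U.toSet
  nA : ∀ p, p ∈ A.toSet → p ∉ U.toSet
  nB : ∀ p, p ∈ B.toSet → p ∉ U.toSet

variable {A B P Q U U' : GridPath}

theorem PureFor.endpointA (h : PureFor A B P) {p : ℤ × ℤ} (hp : p ∈ A.toSet) (hp' : p ∈ P.toSet) :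
    P.IsEndpoint p := (h.dA p hp hp').resolve_left fun he => h.pA p he hp'

theorem PureFor.endpointB (h : PureFor A B P) {p : ℤ × ℤ} (hp : p ∈ B.toSet) (hp' : p ∈ P.toSet) :
    P.IsEndpoint p := (h.dB p hp hp').resolve_left fun he => h.pB p he hp'

theorem PureFor.ends (h : PureFor A B P) (hAB : IntDisj A B) :
    (P.first ∈ A.toSet ∧ P.last ∈ B.toSet) ∨ (P.first ∈ B.toSet ∧ P.last ∈ A.toSet) := by
  obtain ⟨p, hpA, hpP⟩ := h.mA
  obtain ⟨q, hqB, hqP⟩ := h.mB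
  have hne : p ≠ q := by
    rintro rfl
    rcases hAB p hpA hqB with h' | h'
    · exact h.pA p h' hpP
    · exact h.pB p h' hpP
  rcases h.endpointA hpA hpP with rfl | rfl <;> rcases h.endpointB hqB hqP with rfl | rfl
  · exact absurd rfl hne
  · exact Or.inl ⟨hpA, hqB⟩
  · exact Or.inr ⟨hqB, hpA⟩
  · exact absurd rfl hne

theorem PureFor.not_endpoint (h : PureFor A B P) (hAB : IntDisj A B)
    (nA : ∀ p, p ∈ A.toSet → p ∉ U.toSet) (nB : ∀ p, p ∈ B.toSet → p ∉ U.toSet)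
    {p : ℤ × ℤ} (hp : p ∈ U.toSet) : ¬ P.IsEndpoint p := by
  rintro (rfl | rfl) <;> rcases h.ends hAB with ⟨h1, h2⟩ | ⟨h1, h2⟩
  · exact nA _ h1 hp
  · exact nB _ h1 hp
  · exact nB _ h2 hp
  · exact nA _ h2 hp

theorem SewFor.contactP (s : SewFor A B P Q U) (h : PureFor A B P) (hAB : IntDisj A B)
    {p : ℤ × ℤ} (hp : p ∈ P.toSet) (hu : p ∈ U.toSet) : U.IsEndpoint p :=
  (s.dP p hp hu).resolve_left (h.not_endpoint hAB s.nA s.nB hu)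

theorem SewFor.swap (s : SewFor A B P Q U) : SewFor A B Q P U :=
  ⟨s.dQ, s.dP, s.mQ, s.mP, s.nA, s.nB⟩

theorem SewFor.endpoint_mem (s : SewFor A B P Q U) (hP : PureFor A B P) (hQ : PureFor A B Q)
    (hAB : IntDisj A B) (hPQ : ∀ p, p ∈ P.toSet → p ∉ Q.toSet) {x : ℤ × ℤ}
    (hx : U.IsEndpoint x) : x ∈ P.toSet ∨ x ∈ Q.toSet := by
  obtain ⟨p, hp, hpU⟩ := s.mP
  obtain ⟨q, hq, hqU⟩ := s.mQ
  have hne : p ≠ q := by rintro rfl; exact hPQ p hp hq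
  have e1 := s.contactP hP hAB hp hpU
  have e2 := s.swap.contactP hQ hAB hq hqU
  unfold GridPath.IsEndpoint at *
  grind

/-- The contact point with `P` is unique. -/
theorem SewFor.unique (s : SewFor A B P Q U) (hP : PureFor A B P) (hQ : PureFor A B Q)
    (hAB : IntDisj A B) (hPQ : ∀ p, p ∈ P.toSet → p ∉ Q.toSet) {x y : ℤ × ℤ}
    (hx : x ∈ P.toSet) (hxU : x ∈ U.toSet) (hy : y ∈ P.toSet) (hyU : y ∈ U.toSet) : y = x := by
  by_contra hne
  obtain ⟨q, hq, hqU⟩ := s.mQ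
  have e1 := s.contactP hP hAB hx hxU
  have e2 := s.contactP hP hAB hy hyU
  have e3 := s.swap.contactP hQ hAB hq hqU
  have h1 : x ≠ q := by rintro rfl; exact hPQ _ hx hq
  have h2 : y ≠ q := by rintro rfl; exact hPQ _ hy hq
  unfold GridPath.IsEndpoint at *
  grind

theorem core_bend (hP : PureFor A B P) (hQ : PureFor A B Q) (hAB : IntDisj A B)
    (mAB : ∃ p, p ∈ A.toSet ∧ p ∈ B.toSet) (hPQ : ∀ p, p ∈ P.toSet → p ∉ Q.toSet)
    (s : SewFor A B P Q U) (s' : SewFor A B P Q U')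
    (hseg : ∀ p q, ConsecIn U.pts p q → ¬ ConsecIn U'.pts p q)
    {x : ℤ × ℤ} (hx : x ∈ U.toSet) (hx' : x ∈ U'.toSet) (hxP : x ∈ P.toSet) :
    U.IsEndpoint x ∧ U'.IsEndpoint x ∧ P.IsBend x := by
  have eU := s.contactP hP hAB hxP hx
  have eU' := s'.contactP hP hAB hxP hx'
  refine ⟨eU, eU', ?_⟩
  have nx := hP.not_endpoint hAB s.nA s.nB hx
  obtain ⟨l, r, hin, sl, sr, hlr, hl, hr, cl, cr⟩ := P.interior_split hxP nx
  obtain ⟨y, hy, sy, ky, cy⟩ := U.endpoint_split eU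
  obtain ⟨z, hz, sz, kz, cz⟩ := U'.endpoint_split eU'
  have hyz : y ≠ z := by rintro rfl; exact hseg _ _ ky kz
  obtain ⟨q, hq, hqU⟩ := s.mQ
  obtain ⟨q', hq', hqU'⟩ := s'.mQ
  have hqx : q ≠ x := by rintro rfl; exact hPQ _ hxP hq
  have hqx' : q' ≠ x := by rintro rfl; exact hPQ _ hxP hq'
  have iq : Q.IsInterior q := ⟨hq, hQ.not_endpoint hAB s.nA s.nB hqU⟩
  have iq' : Q.IsInterior q' := ⟨hq', hQ.not_endpoint hAB s'.nA s'.nB hqU'⟩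
  obtain ⟨c, hcA, hcB⟩ := mAB
  set C : Set (ℤ × ℤ) := (P.toSet \ {x}) ∪ (A.toSet ∪ B.toSet) with hCdef
  set D : Set (ℤ × ℤ) := (U.toSet \ {x}) ∪ ((U'.toSet \ {x}) ∪ {z | Q.IsInterior z}) with hDdef
  have iP : P.toSet \ {x} ⊆ C := Set.subset_union_left
  have iA : A.toSet ⊆ C := fun w hw => Or.inr (Or.inl hw)
  have iB : B.toSet ⊆ C := fun w hw => Or.inr (Or.inr hw)
  have iU : U.toSet \ {x} ⊆ D := Set.subset_union_left
  have iU' : U'.toSet \ {x} ⊆ D := fun w hw => Or.inr (Or.inl hw)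
  have iQ : {z | Q.IsInterior z} ⊆ D := fun w hw => Or.inr (Or.inr hw)
  have cC : ConnIn C l r := by
    refine (cl.mono iP).symm.trans (ConnIn.trans ?_ (cr.mono iP).symm)
    rcases hP.ends hAB with ⟨h1, h2⟩ | ⟨h1, h2⟩
    · exact ((A.conn h1 hcA).mono iA).trans ((B.conn hcB h2).mono iB)
    · exact ((B.conn h1 hcB).mono iB).trans ((A.conn hcA h2).mono iA)
  have cD : ConnIn D y z :=
    ((cy q hqU hqx).mono iU).trans
      (((Q.interior_conn iq iq').mono iQ).trans ((cz q' hqU' hqx').mono iU').symm)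
  have hxC : x ∉ C := by
    rintro (h | h | h)
    · exact h.2 rfl
    · exact s.nA _ h hx
    · exact s.nB _ h hx
  have hxD : x ∉ D := by
    rintro (h | h | h)
    · exact h.2 rfl
    · exact h.2 rfl
    · exact hPQ _ hxP h.1
  have hdis : ∀ w ∈ D, w ∉ C := by
    rintro w (h | h | h) (h' | h' | h')
    · exact h.2 (s.unique hP hQ hAB hPQ hxP hx h'.1 h.1)
    · exact s.nA _ h' h.1
    · exact s.nB _ h' h.1
    · exact h.2 (s'.unique hP hQ hAB hPQ hxP hx' h'.1 h.1)
    · exact s'.nA _ h' h.1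
    · exact s'.nB _ h' h.1
    · exact hPQ _ h'.1 h.1
    · exact h.2 (hQ.endpointA h' h.1)
    · exact h.2 (hQ.endpointB h' h.1)
  have := no_crossing_gen hxC hxD hdis (iP hl) (iP hr) cC (iU hy) (iU' hz) cD sl sr sy sz hlr hyz
  exact ⟨l, r, hin, this.1, this.2⟩

theorem pureFor_of_isPure {k : ℕ} (R : CPGRep (Gk k)) (i : Fin 20) (h : IsPure R (GkV.α i)) :
    PureFor (R.path GkV.a) (R.path GkV.b) (R.path (GkV.α i)) where
  dA := R.interiorly_disjoint _ _ (by simp)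
  dB := R.interiorly_disjoint _ _ (by simp)
  mA := (R.adj_iff _ _ (by simp)).1 ⟨by simp, Or.inl (GkRel.aα i)⟩
  mB := (R.adj_iff _ _ (by simp)).1 ⟨by simp, Or.inl (GkRel.bα i)⟩
  pA := fun p hp => h p (Or.inl hp)
  pB := fun p hp => h p (Or.inr hp)

theorem sewFor_of_rep {k : ℕ} (R : CPGRep (Gk k)) (i : Fin 19) (j : Fin (k + 2)) :
    SewFor (R.path GkV.a) (R.path GkV.b) (R.path (GkV.α i.castSucc)) (R.path (GkV.α i.succ))
      (R.path (GkV.u i j)) where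
  dP := R.interiorly_disjoint _ _ (by simp)
  dQ := R.interiorly_disjoint _ _ (by simp)
  mP := (R.adj_iff _ _ (by simp)).1 ⟨by simp, Or.inl (GkRel.αu i j)⟩
  mQ := (R.adj_iff _ _ (by simp)).1 ⟨by simp, Or.inl (GkRel.α'u i j)⟩
  nA := by
    intro p hp hp'
    obtain ⟨_, h | h⟩ := (R.adj_iff GkV.a (GkV.u i j) (by simp)).2 ⟨p, hp, hp'⟩ <;> cases h
  nB := by
    intro p hp hp'
    obtain ⟨_, h | h⟩ := (R.adj_iff GkV.b (GkV.u i j) (by simp)).2 ⟨p, hp, hp'⟩ <;> cases h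

theorem not_gkRel_αα {k : ℕ} (i i' : Fin 20) : ¬ GkRel k (GkV.α i) (GkV.α i') := by
  intro h
  cases h

/-- Claim 2 of the paper: if `P_{α_i}` and `P_{α_{i+1}}` are pure and a grid point `x`
belongs to both sewing paths `P_{u^i_j}` and `P_{u^i_{j+1}}` (here `j`, `j'` are the
0-based indices, with `j' = j + 1`), then `x` is an endpoint of both sewing paths and a
bend point of `P_{α_i}` or of `P_{α_{i+1}}`. -/
theorem contact_of_consecutive_sewing_paths (k : ℕ) (R : CPGRep (Gk k)) (i : Fin 19)
    (hpure₁ : IsPure R (GkV.α i.castSucc)) (hpure₂ : IsPure R (GkV.α i.succ))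
    (j j' : Fin (k + 2)) (hjj' : (j : ℕ) + 1 = (j' : ℕ)) (x : ℤ × ℤ)
    (hx : x ∈ (R.path (GkV.u i j)).toSet) (hx' : x ∈ (R.path (GkV.u i j')).toSet) :
    (R.path (GkV.u i j)).IsEndpoint x ∧ (R.path (GkV.u i j')).IsEndpoint x ∧
      ((R.path (GkV.α i.castSucc)).IsBend x ∨ (R.path (GkV.α i.succ)).IsBend x) := by
  have hP := pureFor_of_isPure R _ hpure₁
  have hQ := pureFor_of_isPure R _ hpure₂
  have s := sewFor_of_rep R i j
  have s' := sewFor_of_rep R i j'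
  have hAB : IntDisj (R.path GkV.a) (R.path GkV.b) := R.interiorly_disjoint _ _ (by simp)
  have mAB := (R.adj_iff GkV.a GkV.b (by simp)).1 ⟨by simp, Or.inl GkRel.ab⟩
  have hii : i.castSucc ≠ i.succ := (Fin.castSucc_lt_succ).ne
  have hPQ : ∀ p, p ∈ (R.path (GkV.α i.castSucc)).toSet → p ∉ (R.path (GkV.α i.succ)).toSet := by
    intro p hp hp'
    obtain ⟨_, h | h⟩ := (R.adj_iff (GkV.α i.castSucc) (GkV.α i.succ) (by simpa using hii)).2
      ⟨p, hp, hp'⟩ <;> exact not_gkRel_αα _ _ h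
  have hjne : GkV.u i j ≠ GkV.u i j' := by
    intro h
    injection h with _ h
    rw [h] at hjj'
    omega
  have hseg := R.no_shared_segment _ _ hjne
  have hmem : x ∈ (R.path (GkV.α i.castSucc)).toSet ∨ x ∈ (R.path (GkV.α i.succ)).toSet := by
    rcases R.interiorly_disjoint _ _ hjne x hx hx' with h | h
    · exact s.endpoint_mem hP hQ hAB hPQ h
    · exact s'.endpoint_mem hP hQ hAB hPQ h
  rcases hmem with h | h
  · obtain ⟨h1, h2, h3⟩ := core_bend hP hQ hAB mAB hPQ s s' hseg hx hx' h
    exact ⟨h1, h2, Or.inl h3⟩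
  · obtain ⟨h1, h2, h3⟩ := core_bend hQ hP hAB mAB (fun p hp hp' => hPQ p hp' hp)
      s.swap s'.swap hseg hx hx' h
    exact ⟨h1, h2, Or.inr h3⟩
end
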